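/- Let 0 < ε₁ < 1 and let N be an even integer with N ≥ exp(8·exp(31.52)). Set z = N^{1/8}, y = N^{1/3}, and let c̄ = ∫_{1/8}^{1/3} log(2 − 3β)/(β(1−β)) dβ (one has c̄ < 0.363084). Then the number of triples (p₁, p₂, p₃) of primes with z ≤ p₁ < y ≤ p₂ ≤ p₃ and p₁p₂p₃ < (1+ε₁)·N is at most (1 + ε₁ + 9/log N) · N · ( c̄/log N + 36/(log N)³ + (log(8/3) + 64/(log N)²)·( 10·log(1+ε₁)/(log N)² + 27/(log N)³ ) ). -/

import Mathlib

open Real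

namespace TC
open Complex MeasureTheory Set Filter Topology Asymptotics

/-- the fractional part, supported on `(1, ∞)` -/
noncomputable def fr : ℝ → ℂ := indicator (Ioi 1) (fun u => ((Int.fract u : ℝ) : ℂ))

/-- `∫_1^∞ {u} u^{-s-1} du` -/
noncomputable def KK (s : ℂ) : ℂ := mellin fr (-s)

lemma norm_fr_le (u : ℝ) : ‖fr u‖ ≤ 1 := by
  unfold fr
  by_cases h : u ∈ Ioi (1:ℝ)
  · rw [indicator_of_mem h, Complex.norm_real, Real.norm_eq_abs, abs_of_nonneg (Int.fract_nonneg u)]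
    exact (Int.fract_lt_one u).le
  · rw [indicator_of_notMem h]; simp

lemma measurable_fr : Measurable fr := by
  unfold fr
  exact (Complex.measurable_ofReal.comp measurable_fract).indicator measurableSet_Ioi

lemma locInt_fr : LocallyIntegrableOn fr (Ioi 0) := by
  apply LocallyIntegrable.locallyIntegrableOn
  have : LocallyIntegrable (fun _ : ℝ => (1:ℝ)) := locallyIntegrable_const 1
  exact this.mono measurable_fr.aestronglyMeasurable (ae_of_all _ fun x => by simpa using norm_fr_le x)

lemma fr_top : fr =O[atTop] (fun x : ℝ => x ^ (-(0:ℝ))) := by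
  refine IsBigO.of_bound 1 (Eventually.of_forall fun x => ?_)
  simpa using norm_fr_le x

lemma bigO_zero_of_Ioi_one {f : ℝ → ℂ} (hf : ∀ x, x ≤ 1 → f x = 0) (b : ℝ) :
    f =O[𝓝[>] 0] (fun x : ℝ => x ^ (-b)) := by
  have : f =ᶠ[𝓝[>] 0] (fun _ => (0:ℂ)) := by
    have h1 : Iio (1:ℝ) ∈ 𝓝[>] (0:ℝ) := mem_nhdsWithin_of_mem_nhds (Iio_mem_nhds one_pos)
    filter_upwards [h1] with x hx
    exact hf x (le_of_lt hx)
  exact this.trans_isBigO (isBigO_zero _ _)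

lemma fr_zero (x : ℝ) (hx : x ≤ 1) : fr x = 0 := by
  unfold fr; rw [indicator_of_notMem]; simpa using hx

lemma KK_diff {s : ℂ} (hs : 0 < s.re) : DifferentiableAt ℂ KK s := by
  have h := mellin_differentiableAt_of_isBigO_rpow (s := -s) (a := 0) (b := (-s).re - 1) locInt_fr
    fr_top (by simpa using hs) (bigO_zero_of_Ioi_one fr_zero _) (by linarith)
  exact DifferentiableAt.comp s h differentiableAt_id.neg

lemma KK_eq (s : ℂ) : KK s = ∫ u in Ioi (1:ℝ), ((Int.fract u : ℝ) : ℂ) * (u:ℂ) ^ (-s - 1) := by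
  unfold KK mellin fr
  have : ∀ u : ℝ, (u:ℂ) ^ (-s - 1) • indicator (Ioi 1) (fun u : ℝ => ((Int.fract u : ℝ) : ℂ)) u
     = indicator (Ioi 1) (fun u : ℝ => ((Int.fract u : ℝ) : ℂ) * (u:ℂ) ^ (-s - 1)) u := by
    intro u
    by_cases h : u ∈ Ioi (1:ℝ)
    · rw [indicator_of_mem h, indicator_of_mem h, smul_eq_mul, mul_comm]
    · rw [indicator_of_notMem h, indicator_of_notMem h]; simp
  simp_rw [this]
  rw [setIntegral_indicator measurableSet_Ioi]
  congr 2
  ext x; simp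

lemma norm_KK_le {s : ℂ} (hs : 0 < s.re) : ‖KK s‖ ≤ 1 / s.re := by
  rw [KK_eq]
  have h1 : ∫ u in Ioi (1:ℝ), u ^ (-s.re - 1) = 1 / s.re := by
    rw [integral_Ioi_rpow_of_lt (by linarith) one_pos]
    simp
  rw [← h1]
  refine norm_integral_le_of_norm_le (integrableOn_Ioi_rpow_of_lt (by linarith) one_pos) ?_
  refine (ae_restrict_iff' measurableSet_Ioi).2 (ae_of_all _ fun u hu => ?_)
  have hu' : (0:ℝ) < u := lt_trans one_pos hu
  rw [norm_mul, Complex.norm_real, Real.norm_eq_abs, abs_of_nonneg (Int.fract_nonneg u),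
    Complex.norm_cpow_eq_rpow_re_of_pos hu']
  simp only [sub_re, neg_re, one_re]
  have := Real.rpow_nonneg hu'.le (-s.re - 1)
  nlinarith [Int.fract_lt_one u, Int.fract_nonneg u]

lemma zeta1_eq_of_one_lt {s : ℂ} (hs : 1 < s.re) :
    riemannZeta₁ s = s - s * (s - 1) * KK s := by
  have hs1 : s ≠ 1 := by rintro rfl; simp at hs
  have hs1' : s - 1 ≠ 0 := sub_ne_zero.2 hs1
  have h1 := LSeries_eq_mul_integral_of_nonneg (fun _ => (1:ℝ)) (r := 1) zero_le_one hs
    (by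
      refine IsBigO.of_bound 1 (Eventually.of_forall fun n => ?_)
      simp) (fun _ => zero_le_one)
  have h2 : LSeries (fun n => ((1:ℝ):ℂ)) s = riemannZeta s := by
    have := LSeries_one_eq_riemannZeta hs
    rw [← this]; congr 1
  rw [h2] at h1
  have hI : IntegrableOn (fun u : ℝ => (u:ℂ) ^ (-s)) (Ioi 1) :=
    integrableOn_Ioi_cpow_of_lt (by simpa using hs) one_pos
  have hI2 : IntegrableOn (fun u : ℝ => ((Int.fract u : ℝ) : ℂ) * (u:ℂ) ^ (-s - 1)) (Ioi 1) := by
    have h3 : IntegrableOn (fun u : ℝ => (u:ℂ) ^ (-s-1)) (Ioi 1) :=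
      integrableOn_Ioi_cpow_of_lt (by simp; linarith) one_pos
    refine h3.bdd_mul (c := 1) ((Complex.measurable_ofReal.comp measurable_fract).aestronglyMeasurable) ?_
    refine ae_of_all _ fun u => ?_
    rw [Complex.norm_real, Real.norm_eq_abs, abs_of_nonneg (Int.fract_nonneg u)]
    exact (Int.fract_lt_one u).le
  have h3 : (∫ t in Ioi (1 : ℝ), (∑ k ∈ Finset.Icc 1 ⌊t⌋₊, (((1:ℝ)):ℂ)) * (t:ℂ) ^ (-(s + 1)))
     = 1 / (s-1) - KK s := by
    have h4 : ∫ u in Ioi (1:ℝ), (u:ℂ) ^ (-s) = 1 / (s - 1) := by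
      rw [integral_Ioi_cpow_of_lt (by simpa using hs) one_pos]
      simp
      rw [show -s + 1 = - (s - 1) by ring, neg_div_neg_eq, one_div]
    rw [KK_eq, ← h4, ← integral_sub hI hI2]
    refine setIntegral_congr_fun measurableSet_Ioi fun u hu => ?_
    have hu' : (0:ℝ) < u := lt_trans one_pos hu
    have hu0 : (u:ℂ) ≠ 0 := by exact_mod_cast hu'.ne'
    have e1 : (∑ k ∈ Finset.Icc 1 ⌊u⌋₊, (((1:ℝ)):ℂ)) = (u:ℂ) - ((Int.fract u : ℝ):ℂ) := by
      simp only [Finset.sum_const, Nat.card_Icc, ofReal_one]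
      have := natCast_floor_eq_intCast_floor hu'.le (R := ℝ)
      have e2 : (⌊u⌋₊ : ℝ) = u - Int.fract u := by rw [this]; simp
      have e3 : (⌊u⌋₊ : ℂ) = ((u - Int.fract u : ℝ):ℂ) := by rw [← e2]; simp
      rw [← ofReal_sub, ← e3]; simp
    simp only [e1]
    rw [sub_mul, show -(s+1) = -s - 1 by ring]
    congr 1
    rw [Complex.cpow_sub _ _ hu0, Complex.cpow_one]
    field_simp
  rw [h3] at h1
  have h5 := riemannZeta_eq_inv_sub_mul hs1
  have : riemannZeta₁ s = (s - 1) * riemannZeta s := by rw [h5]; field_simp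
  rw [this, h1]; field_simp

lemma zeta1_eq {s : ℂ} (hs : 0 < s.re) : riemannZeta₁ s = s - s * (s - 1) * KK s := by
  have hU : IsOpen {s : ℂ | 0 < s.re} := isOpen_lt continuous_const continuous_re
  have h1 : AnalyticOnNhd ℂ riemannZeta₁ {s : ℂ | 0 < s.re} :=
    (differentiable_riemannZeta₁.differentiableOn).analyticOnNhd hU
  have h2 : AnalyticOnNhd ℂ (fun s => s - s * (s - 1) * KK s) {s : ℂ | 0 < s.re} := by
    apply DifferentiableOn.analyticOnNhd _ hU
    intro s hs
    have := KK_diff hs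
    apply DifferentiableAt.differentiableWithinAt
    fun_prop
  have hc : IsPreconnected {s : ℂ | 0 < s.re} := (convex_halfSpace_re_gt 0).isPreconnected
  have := h1.eqOn_of_preconnected_of_eventuallyEq h2 hc (z₀ := 2) (by simp) (by
    have h3 : {s : ℂ | 1 < s.re} ∈ 𝓝 (2:ℂ) :=
      (isOpen_lt continuous_const continuous_re).mem_nhds (by simp)
    filter_upwards [h3] with z hz using zeta1_eq_of_one_lt hz)
  exact this hs

lemma zeta1_bound {s : ℂ} (hs : 0 < s.re) : ‖riemannZeta₁ s‖ ≤ ‖s‖ * (1 + ‖s - 1‖ / s.re) := by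
  rw [zeta1_eq hs]
  have : s - s * (s - 1) * KK s = s * (1 - (s-1) * KK s) := by ring
  rw [this, norm_mul]
  gcongr
  refine (norm_sub_le _ _).trans ?_
  rw [norm_mul, norm_one, div_eq_mul_one_div]
  gcongr
  exact norm_KK_le hs

lemma zeta1_ne_zero_near {s : ℂ} (h : ‖s - 1‖ < s.re) : riemannZeta₁ s ≠ 0 := by
  have hs : 0 < s.re := lt_of_le_of_lt (norm_nonneg _) h
  rw [zeta1_eq hs]
  have : s - s * (s - 1) * KK s = s * (1 - (s-1) * KK s) := by ring
  rw [this]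
  refine mul_ne_zero (by rintro rfl; simp at hs) ?_
  intro h0
  have h1 : (s-1) * KK s = 1 := (sub_eq_zero.1 h0).symm
  have h2 : ‖(s-1) * KK s‖ < 1 := by
    rw [norm_mul]
    calc ‖s-1‖ * ‖KK s‖ ≤ ‖s-1‖ * (1 / s.re) := by gcongr; exact norm_KK_le hs
      _ < s.re * (1 / s.re) := by gcongr
      _ = 1 := by field_simp
  rw [h1] at h2; simp at h2

lemma zeta1_eq_mul {s : ℂ} (hs : s ≠ 1) : riemannZeta₁ s = (s - 1) * riemannZeta s := by
  have hs1' : s - 1 ≠ 0 := sub_ne_zero.2 hs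
  rw [riemannZeta_eq_inv_sub_mul hs]; field_simp

lemma zeta1_ne_zero_of_one_le {s : ℂ} (hs : 1 ≤ s.re) : riemannZeta₁ s ≠ 0 := by
  by_cases h : s = 1
  · subst h; simp
  · rw [zeta1_eq_mul h]
    exact mul_ne_zero (sub_ne_zero.2 h) (riemannZeta_ne_zero_of_one_le_re hs)

lemma zeta1_lower {s : ℂ} (hs : 1 < s.re) :
    ‖s - 1‖ * ((s.re - 1) / (2 * s.re - 1)) ≤ ‖riemannZeta₁ s‖ := by
  have hs1 : s ≠ 1 := by rintro rfl; simp at hs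
  rw [zeta1_eq_mul hs1, norm_mul]
  gcongr
  set σ := s.re
  have hσ1 : (σ:ℂ) ≠ 1 := by
    intro h; have : σ = 1 := by exact_mod_cast h
    linarith
  -- zeta at sigma
  have hz : ‖riemannZeta σ‖ ≤ (2 * σ - 1) / (σ - 1) := by
    have h1 := zeta1_bound (s := (σ:ℂ)) (by simp; linarith)
    rw [zeta1_eq_mul hσ1, norm_mul] at h1
    have e1 : ‖(σ:ℂ) - 1‖ = σ - 1 := by
      rw [show (σ:ℂ) - 1 = ((σ - 1 : ℝ):ℂ) by simp, Complex.norm_real, Real.norm_eq_abs, abs_of_pos (by linarith)]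
    have e2 : ‖(σ:ℂ)‖ = σ := by
      rw [Complex.norm_real, Real.norm_eq_abs, abs_of_pos (by linarith)]
    rw [e1, e2, ofReal_re] at h1
    rw [le_div_iff₀ (by linarith)]
    have : σ * (1 + (σ - 1)/σ) = 2 * σ - 1 := by field_simp [show σ ≠ 0 by linarith]; ring
    linarith
  have hmul := ArithmeticFunction.LSeries_zeta_mul_Lseries_moebius hs
  rw [ArithmeticFunction.LSeries_zeta_eq_riemannZeta hs] at hmul
  have hmu : ‖LSeries (fun n => ((ArithmeticFunction.moebius n : ℤ) : ℂ)) s‖ ≤ ‖riemannZeta σ‖ := by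
    have hsum : Summable (fun n : ℕ => 1 / (n:ℝ) ^ σ) := Real.summable_one_div_nat_rpow.2 hs
    have hz2 : ‖riemannZeta σ‖ = ∑' n : ℕ, 1 / (n:ℝ) ^ σ := by
      rw [zeta_eq_tsum_one_div_nat_cpow (by simpa using hs)]
      have : (∑' n : ℕ, 1 / (n:ℂ) ^ (σ:ℂ)) = ((∑' n : ℕ, 1 / (n:ℝ) ^ σ : ℝ) : ℂ) := by
        rw [Complex.ofReal_tsum]
        congr 1; ext n
        push_cast
        rw [Complex.ofReal_cpow (by positivity)]
        simp
      rw [this, Complex.norm_real, Real.norm_eq_abs, abs_of_nonneg]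
      exact tsum_nonneg fun n => by positivity
    rw [hz2, LSeries]
    have hle : ∀ n : ℕ, ‖LSeries.term (fun n => ((ArithmeticFunction.moebius n : ℤ) : ℂ)) s n‖ ≤ 1 / (n:ℝ) ^ σ := by
      intro n
      rcases Nat.eq_zero_or_pos n with rfl | hn
      · simp; positivity
      rw [LSeries.term_of_ne_zero hn.ne', norm_div, Complex.norm_natCast_cpow_of_pos hn]
      gcongr
      have := @ArithmeticFunction.abs_moebius_le_one n
      rw [Complex.norm_intCast]
      exact_mod_cast this
    have hs2 : Summable fun n => ‖LSeries.term (fun n => ((ArithmeticFunction.moebius n : ℤ) : ℂ)) s n‖ :=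
      Summable.of_nonneg_of_le (fun _ => norm_nonneg _) hle hsum
    exact (norm_tsum_le_tsum_norm hs2).trans (hs2.tsum_le_tsum hle hsum)
  have h1 : 1 ≤ ‖riemannZeta s‖ * ((2 * σ - 1) / (σ - 1)) := by
    calc (1:ℝ) = ‖riemannZeta s * LSeries (fun n => ((ArithmeticFunction.moebius n : ℤ) : ℂ)) s‖ := by rw [hmul]; simp
      _ ≤ _ := by rw [norm_mul]; gcongr; exact hmu.trans hz
  rw [div_le_iff₀ (by linarith)]
  rw [mul_div_assoc', le_div_iff₀ (by linarith)] at h1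
  linarith

end TC

namespace TC
open Complex MeasureTheory Set Filter Topology Asymptotics Metric

lemma exists_log_bound {f : ℂ → ℂ} (hf : Differentiable ℂ f) {R M : ℝ} (hR : 0 < R) (hM : 0 < M)
    (hne : ∀ z, ‖z‖ < R → f z ≠ 0) (hb : ∀ z, ‖z‖ < R → ‖f z‖ ≤ Real.exp M * ‖f 0‖) :
    ∃ h : ℂ → ℂ, (∀ z, ‖z‖ < R → HasDerivAt h (deriv f z / f z) z) ∧
      ∀ z, ‖z‖ < R → ‖h z‖ ≤ 2 * M * ‖z‖ / (R - ‖z‖) := by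
  have hd : DifferentiableOn ℂ (fun z => deriv f z / f z) (ball 0 R) := by
    intro z hz
    have hz' : ‖z‖ < R := by simpa using hz
    have h1 : DifferentiableAt ℂ (deriv f) z := by
      have := hf.analyticAt z
      exact this.deriv.differentiableAt
    exact (h1.div (hf z) (hne z hz')).differentiableWithinAt
  obtain ⟨h, h0, hh⟩ := hd.isExactOn_ball.with_val_at 0 0
  have hmem : ∀ z : ℂ, ‖z‖ < R → z ∈ ball (0:ℂ) R := fun z hz => by simpa using hz
  refine ⟨h, fun z hz => hh z (hmem z hz), ?_⟩
  have hconst : ∀ z ∈ ball (0:ℂ) R, f z * cexp (- h z) = f 0 := by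
    intro z hz
    have key := (convex_ball (0:ℂ) R).is_const_of_fderivWithin_eq_zero (𝕜 := ℂ)
      (f := fun z => f z * cexp (- h z)) ?_ ?_ hz (mem_ball_self hR)
    · simpa [h0] using key
    · intro w hw
      exact ((hf w).mul ((hh w hw).differentiableAt.neg.cexp)).differentiableWithinAt
    · intro w hw
      have h1 : HasDerivAt (fun z => f z * cexp (- h z)) 0 w := by
        have h2 : HasDerivAt (fun z => f z * cexp (- h z)) (deriv f w * cexp (- h w) + f w * (cexp (- h w) * -(deriv f w / f w))) w :=
          (hf w).hasDerivAt.mul ((hh w hw).neg.cexp)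
        have h3 := hne w (by simpa using hw)
        have h4 : deriv f w * cexp (- h w) + f w * (cexp (- h w) * -(deriv f w / f w)) = 0 := by
          field_simp; ring
        rwa [h4] at h2
      rw [fderivWithin_of_isOpen isOpen_ball hw]
      ext
      simp [h1.hasFDerivAt.fderiv]
  have h00 : f 0 ≠ 0 := hne 0 (by simpa using hR)
  intro z hz
  refine borelCaratheodory_zero hM (fun w hw => (hh w hw).differentiableAt.differentiableWithinAt)
    ?_ hR (hmem z hz) h0
  intro w hw
  have e := hconst w hw
  have e2 : ‖f w‖ = ‖f 0‖ * Real.exp (h w).re := by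
    rw [← e, norm_mul, Complex.norm_exp, mul_assoc, ← Real.exp_add]; simp
  have e3 := hb w (by simpa using hw)
  rw [e2] at e3
  have : Real.exp (h w).re ≤ Real.exp M := by
    have := norm_pos_iff.2 h00
    nlinarith
  exact Real.exp_le_exp.1 this

lemma logderiv_bound_zero {f : ℂ → ℂ} (hf : Differentiable ℂ f) {R M : ℝ} (hR : 0 < R) (hM : 0 < M)
    (hne : ∀ z, ‖z‖ < R → f z ≠ 0) (hb : ∀ z, ‖z‖ < R → ‖f z‖ ≤ Real.exp M * ‖f 0‖) :
    ‖deriv f 0 / f 0‖ ≤ 9 / 4 * M / R := by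
  obtain ⟨h, h1, h2⟩ := exists_log_bound hf hR hM hne hb
  have := norm_deriv_le_of_forall_mem_sphere_norm_le (c := 0) (R := R / 10) (C := 2 / 9 * M) (f := h)
    (by positivity) ?_ ?_
  · rw [(h1 0 (by simpa using hR)).deriv] at this
    refine this.trans ?_
    rw [div_le_div_iff₀ (by positivity) hR]; nlinarith [mul_pos hM hR]
  · refine DifferentiableOn.diffContOnCl (fun z hz => ?_)
    rw [closure_ball _ (by positivity)] at hz
    have : ‖z‖ < R := by have : ‖z‖ ≤ R / 10 := by simpa using hz
                         linarith
    exact (h1 z this).differentiableAt.differentiableWithinAt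
  · intro z hz
    have hz' : ‖z‖ = R / 10 := by simpa using hz
    have := h2 z (by rw [hz']; linarith)
    rw [hz'] at this
    refine this.trans (le_of_eq ?_)
    field_simp; ring

lemma logderiv_bound {f : ℂ → ℂ} (hf : Differentiable ℂ f) {R M : ℝ} (hR : 0 < R) (hM : 0 < M)
    (hne : ∀ z, ‖z‖ < R → f z ≠ 0) (hb : ∀ z, ‖z‖ < R → ‖f z‖ ≤ Real.exp M * ‖f 0‖)
    {w : ℂ} (hw : ‖w‖ ≤ 2 * R / 3) :
    ‖deriv f w / f w‖ ≤ 60 * M / R := by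
  obtain ⟨h, h1, h2⟩ := exists_log_bound hf hR hM hne hb
  have hlt : ∀ z ∈ closedBall w (R / 6), ‖z‖ ≤ 5 * R / 6 := by
    intro z hz
    have h3 : ‖z - w‖ ≤ R / 6 := by simpa [dist_eq_norm] using hz
    have h4 := norm_add_le (z - w) w
    simp at h4
    linarith
  have := norm_deriv_le_of_forall_mem_sphere_norm_le (c := w) (R := R / 6) (C := 10 * M) (f := h)
    (by positivity) ?_ ?_
  · rw [(h1 w (by linarith)).deriv] at this
    refine this.trans ?_
    rw [div_le_div_iff₀ (by positivity) hR]; nlinarith [mul_pos hM hR]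
  · refine DifferentiableOn.diffContOnCl (fun z hz => ?_)
    rw [closure_ball _ (by positivity)] at hz
    exact (h1 z (by linarith [hlt z hz])).differentiableAt.differentiableWithinAt
  · intro z hz
    have hz' := hlt z (sphere_subset_closedBall hz)
    have := h2 z (by linarith)
    refine this.trans ?_
    rw [div_le_iff₀ (by linarith)]
    nlinarith [norm_nonneg z]

lemma blaschke_step {f : ℂ → ℂ} (hf : Differentiable ℂ f) {R : ℝ} (hR : 0 < R) (h0 : f 0 ≠ 0)
    {ρ : ℂ} (hρ : f ρ = 0) (hρR : ‖ρ‖ < R) :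
    ∃ g : ℂ → ℂ, Differentiable ℂ g ∧ (∀ z, ‖z‖ = R → ‖g z‖ = ‖f z‖) ∧ ‖g 0‖ * ‖ρ‖ = ‖f 0‖ * R ∧
      (∀ z, ‖z‖ < R → g z = 0 → f z = 0) ∧
      deriv g 0 / g 0 = deriv f 0 / f 0 + 1 / ρ - (starRingEnd ℂ ρ) / (R:ℂ)^2 := by
  have hρ0 : ρ ≠ 0 := by rintro rfl; exact h0 hρ
  have hRC : (R:ℂ) ≠ 0 := by exact_mod_cast hR.ne'
  set q : ℂ → ℂ := dslope f ρ with hq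
  have hqd : Differentiable ℂ q := by
    have := (differentiableOn_dslope (f := f) (s := univ) (c := ρ) univ_mem).2 hf.differentiableOn
    exact differentiableOn_univ.1 this
  have hfq : ∀ z, f z = (z - ρ) * q z := by
    intro z
    have := sub_smul_dslope f ρ z
    rw [hρ, sub_zero, smul_eq_mul] at this
    exact this.symm
  have hq0 : f 0 = - ρ * q 0 := by rw [hfq 0]; ring
  have hq00 : q 0 ≠ 0 := by intro h; apply h0; rw [hq0, h, mul_zero]
  have hgd : Differentiable ℂ (fun z => q z * (((R:ℂ)^2 - (starRingEnd ℂ ρ) * z) / R)) := by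
    fun_prop
  refine ⟨_, hgd, ?_, ?_, ?_, ?_⟩
  · intro z hz
    rw [hfq z, norm_mul, norm_mul, norm_div, mul_comm]
    congr 1
    have hzz : (R:ℂ)^2 = z * starRingEnd ℂ z := by
      rw [Complex.mul_conj, Complex.normSq_eq_norm_sq, hz]; push_cast; rfl
    rw [hzz, show z * (starRingEnd ℂ) z - (starRingEnd ℂ) ρ * z = z * starRingEnd ℂ (z - ρ) by
      simp; ring, norm_mul, hz, Complex.norm_conj]
    simp [abs_of_pos hR]
    field_simp
  · simp only [mul_zero, sub_zero]
    rw [hq0]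
    simp [abs_of_pos hR]
    field_simp
  · intro z hz hgz
    rcases mul_eq_zero.1 hgz with h | h
    · rw [hfq, h, mul_zero]
    · exfalso
      rw [div_eq_zero_iff] at h
      rcases h with h | h
      · have h1 : (R:ℂ)^2 = starRingEnd ℂ ρ * z := sub_eq_zero.1 h
        have h2 := congrArg norm h1
        simp [abs_of_pos hR] at h2
        nlinarith [norm_nonneg z, norm_nonneg ρ]
      · exact hRC h
  · have hdf : deriv f 0 = q 0 - ρ * deriv q 0 := by
      have h1 : HasDerivAt (fun z => (z - ρ) * q z) (1 * q 0 + (0 - ρ) * deriv q 0) 0 :=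
        ((hasDerivAt_id (0:ℂ)).sub_const ρ).mul (hqd 0).hasDerivAt
      have h2 : f = fun z => (z - ρ) * q z := funext hfq
      rw [h2, h1.deriv]; ring
    have hdg : HasDerivAt (fun z => q z * (((R:ℂ)^2 - (starRingEnd ℂ ρ) * z) / R))
        (deriv q 0 * (((R:ℂ)^2 - (starRingEnd ℂ ρ) * 0) / R) + q 0 * ((-(starRingEnd ℂ ρ * 1)) / R)) 0 :=
      (hqd 0).hasDerivAt.mul ((((hasDerivAt_id (0:ℂ)).const_mul _).const_sub _).div_const _)
    rw [hdg.deriv, hdf, hq0]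
    simp only [mul_zero, sub_zero, mul_one]
    field_simp
    ring

lemma re_blaschke {ρ : ℂ} (_ : ρ ≠ 0) (R : ℝ) :
    (1 / ρ - (starRingEnd ℂ ρ) / (R:ℂ)^2).re = ρ.re * (1 / ‖ρ‖^2 - 1 / R^2) := by
  rw [sub_re, one_div, Complex.inv_re, Complex.normSq_eq_norm_sq]
  rw [show (R:ℂ)^2 = ((R^2:ℝ):ℂ) by push_cast; rfl, Complex.div_ofReal_re]
  simp
  ring

lemma max_mod_le {f : ℂ → ℂ} (hf : Differentiable ℂ f) {R B : ℝ} (hR : 0 < R)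
    (hb : ∀ z, ‖z‖ = R → ‖f z‖ ≤ B) {z : ℂ} (hz : ‖z‖ ≤ R) : ‖f z‖ ≤ B := by
  refine Complex.norm_le_of_forall_mem_frontier_norm_le (U := ball 0 R) isBounded_ball
    hf.diffContOnCl ?_ ?_
  · intro w hw
    rw [frontier_ball _ hR.ne'] at hw
    exact hb w (by simpa using hw)
  · rw [closure_ball _ hR.ne']; simpa using hz

lemma re_logderiv_aux {R R' M B : ℝ} (hR' : 0 < R') (hRR : R' < R) (hM : 0 < M) (n : ℕ) :
    ∀ f : ℂ → ℂ, Differentiable ℂ f → f 0 ≠ 0 → (∀ z, ‖z‖ = R → ‖f z‖ ≤ B) →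
      B ≤ Real.exp M * ‖f 0‖ → (∀ z, ‖z‖ < R → f z = 0 → z.re ≤ 0) →
      B < ‖f 0‖ * (R / R') ^ n → -(9 / 4 * M / R') ≤ (deriv f 0 / f 0).re := by
  have hR : 0 < R := hR'.trans hRR
  induction n with
  | zero =>
    intro f hf h0 hb hB hz hlt
    have := max_mod_le hf hR hb (z := 0) (by simpa using hR.le)
    simp at hlt; linarith
  | succ n ih =>
    intro f hf h0 hb hB hz hlt
    by_cases hc : ∀ z, ‖z‖ < R' → f z ≠ 0
    · have := logderiv_bound_zero hf hR' hM hc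
        (fun z hz => (max_mod_le hf hR hb (by linarith)).trans hB)
      have h2 := Complex.abs_re_le_norm (deriv f 0 / f 0)
      have := neg_abs_le (deriv f 0 / f 0).re
      linarith
    · push Not at hc
      obtain ⟨ρ, hρR, hρ⟩ := hc
      have hρ0 : ρ ≠ 0 := by rintro rfl; exact h0 hρ
      have hρp : 0 < ‖ρ‖ := norm_pos_iff.2 hρ0
      have hf0 : 0 < ‖f 0‖ := norm_pos_iff.2 h0
      obtain ⟨g, hg, g1, g2, g3, g4⟩ := blaschke_step hf hR h0 hρ (hρR.trans hRR)
      have hgge : ‖f 0‖ * (R / R') ≤ ‖g 0‖ := by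
        rw [← mul_div_assoc, div_le_iff₀ hR', ← g2]
        have := norm_nonneg (g 0)
        nlinarith
      have hgge' : ‖f 0‖ ≤ ‖g 0‖ := by
        have : 1 ≤ R / R' := by rw [le_div_iff₀ hR']; linarith
        nlinarith
      have h5 := ih g hg (norm_pos_iff.1 (by linarith)) (fun z hz => (g1 z hz).le.trans (hb z hz))
        (hB.trans (by gcongr)) (fun z hz' hgz => hz z hz' (g3 z hz' hgz))
        (by
          refine hlt.trans_le ?_
          rw [pow_succ', ← mul_assoc]
          have : 0 ≤ (R / R') ^ n := by positivity
          gcongr)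
      rw [g4, add_sub_assoc, add_re, re_blaschke hρ0] at h5
      have h6 : 0 ≤ 1 / ‖ρ‖^2 - 1 / R^2 := by
        rw [sub_nonneg]
        apply one_div_le_one_div_of_le (by positivity)
        gcongr; linarith
      have h7 := hz ρ (by linarith) hρ
      nlinarith

lemma re_logderiv {R R' M : ℝ} (hR' : 0 < R') (hRR : R' < R) (hM : 0 < M)
    {f : ℂ → ℂ} (hf : Differentiable ℂ f) (h0 : f 0 ≠ 0)
    (hb : ∀ z, ‖z‖ = R → ‖f z‖ ≤ Real.exp M * ‖f 0‖)
    (hz : ∀ z, ‖z‖ < R → f z = 0 → z.re ≤ 0) :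
    -(9 / 4 * M / R') ≤ (deriv f 0 / f 0).re := by
  have h1 : 1 < R / R' := by rw [lt_div_iff₀ hR']; linarith
  obtain ⟨n, hn⟩ := pow_unbounded_of_one_lt (Real.exp M) h1
  refine re_logderiv_aux hR' hRR hM n f hf h0 hb le_rfl hz ?_
  rw [mul_comm]
  have := norm_pos_iff.2 h0
  gcongr

lemma re_logderiv_zero {R R' M : ℝ} (hR' : 0 < R') (hRR : R' < R) (hM : 0 < M)
    {f : ℂ → ℂ} (hf : Differentiable ℂ f) (h0 : f 0 ≠ 0)
    (hb : ∀ z, ‖z‖ = R → ‖f z‖ ≤ Real.exp M * ‖f 0‖)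
    (hz : ∀ z, ‖z‖ < R → f z = 0 → z.re ≤ 0) {ρ : ℂ} (hρ : f ρ = 0) (hρR : ‖ρ‖ < R) :
    -(9 / 4 * M / R') + (-ρ.re) * (1 / ‖ρ‖^2 - 1 / R^2) ≤ (deriv f 0 / f 0).re := by
  have hR : 0 < R := hR'.trans hRR
  have hρ0 : ρ ≠ 0 := by rintro rfl; exact h0 hρ
  have hρp : 0 < ‖ρ‖ := norm_pos_iff.2 hρ0
  have hf0 : 0 < ‖f 0‖ := norm_pos_iff.2 h0
  obtain ⟨g, hg, g1, g2, g3, g4⟩ := blaschke_step hf hR h0 hρ hρR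
  have hgge' : ‖f 0‖ ≤ ‖g 0‖ := by
    have : ‖f 0‖ * ‖ρ‖ ≤ ‖g 0‖ * ‖ρ‖ := by rw [g2]; gcongr
    exact le_of_mul_le_mul_right this hρp
  have h5 := re_logderiv hR' hRR hM hg (norm_pos_iff.1 (by linarith))
    (fun z hz => (g1 z hz).le.trans ((hb z hz).trans (by gcongr)))
    (fun z hz' hgz => hz z hz' (g3 z hz' hgz))
  rw [g4, add_sub_assoc, add_re, re_blaschke hρ0] at h5
  linarith

end TC

namespace TC
open Complex MeasureTheory Set Filter Topology Asymptotics Metric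

/-- logarithmic derivative of `(s-1) ζ(s)` -/
noncomputable def ZD (s : ℂ) : ℂ := deriv riemannZeta₁ s / riemannZeta₁ s

noncomputable def vM (n : ℕ) : ℂ := ((ArithmeticFunction.vonMangoldt n : ℝ) : ℂ)

lemma LSeries_vM {s : ℂ} (hs : 1 < s.re) : LSeries vM s = 1 / (s - 1) - ZD s := by
  have hs1 : s ≠ 1 := by rintro rfl; simp at hs
  have hs1' : s - 1 ≠ 0 := sub_ne_zero.2 hs1
  have h := ArithmeticFunction.LSeries_vonMangoldt_eq_deriv_riemannZeta_div hs
  have h0 : riemannZeta s ≠ 0 := riemannZeta_ne_zero_of_one_lt_re hs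
  have hd : deriv riemannZeta₁ s = riemannZeta s + (s - 1) * deriv riemannZeta s := by
    have e : riemannZeta₁ =ᶠ[𝓝 s] fun w => (w - 1) * riemannZeta w := by
      filter_upwards [isOpen_ne.mem_nhds hs1] with w hw
      exact zeta1_eq_mul hw
    rw [e.deriv_eq]
    have h1 : HasDerivAt (fun w : ℂ => (w - 1) * riemannZeta w)
      (1 * riemannZeta s + (s - 1) * deriv riemannZeta s) s :=
      ((hasDerivAt_id s).sub_const 1).mul (differentiableAt_riemannZeta hs1).hasDerivAt
    rw [h1.deriv, one_mul]
  unfold vM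
  rw [h, ZD, hd, zeta1_eq_mul hs1]
  field_simp
  ring

lemma re_term (σ t : ℝ) (n : ℕ) : (LSeries.term vM (σ + t * I) n).re =
    ArithmeticFunction.vonMangoldt n * (Real.exp (-σ * Real.log n) * Real.cos (t * Real.log n)) := by
  rw [LSeries.term_def]
  split_ifs with h
  · simp [h]
  · have hn : (n:ℂ) ≠ 0 := by exact_mod_cast h
    rw [vM, div_eq_mul_inv, ← Complex.cpow_neg, Complex.cpow_def_of_ne_zero hn, Complex.re_ofReal_mul,
      ← Complex.natCast_log]
    generalize Real.log n = l
    congr 1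
    rw [Complex.exp_re]
    congr 1
    · congr 1
      simp
      ring
    · rw [← Real.cos_neg (t * l)]
      congr 1
      simp
      ring

lemma three_four_one {σ : ℝ} (hσ : 1 < σ) (t : ℝ) :
    3 * (ZD (σ + (0:ℝ) * I)).re + 4 * (ZD (σ + t * I)).re + (ZD (σ + (2 * t : ℝ) * I)).re
     ≤ 3 * (1 / ((σ:ℂ) + (0:ℝ) * I - 1)).re + 4 * (1 / ((σ:ℂ) + t * I - 1)).re
       + (1 / ((σ:ℂ) + (2*t:ℝ) * I - 1)).re := by
  have hre : ∀ u : ℝ, 1 < ((σ:ℂ) + u * I).re := by intro u; simpa using hσ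
  have hsum : ∀ u : ℝ, HasSum (fun n => (LSeries.term vM (σ + u * I) n).re)
      ((1 / ((σ:ℂ) + u * I - 1)).re - (ZD (σ + u * I)).re) := by
    intro u
    have h1 := (ArithmeticFunction.LSeriesSummable_vonMangoldt (hre u)).hasSum
    have h2 := Complex.hasSum_re h1
    have h3 := congrArg Complex.re (LSeries_vM (hre u))
    rw [sub_re] at h3
    rw [← h3]
    exact h2
  have hs := (((hsum 0).mul_left 3).add ((hsum t).mul_left 4)).add (hsum (2 * t))
  have := hs.nonneg (fun n => by
    rw [re_term, re_term, re_term]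
    have e : Real.cos (2 * t * Real.log n) = 2 * Real.cos (t * Real.log n) ^ 2 - 1 := by
      rw [← Real.cos_two_mul]; ring_nf
    rw [e, zero_mul, Real.cos_zero]
    have h1 : 0 ≤ ArithmeticFunction.vonMangoldt n * Real.exp (-σ * Real.log n) :=
      mul_nonneg ArithmeticFunction.vonMangoldt_nonneg (Real.exp_nonneg _)
    have h2 : 0 ≤ 2 * (ArithmeticFunction.vonMangoldt n * Real.exp (-σ * Real.log n)) * (1 + Real.cos (t * Real.log n))^2 := by positivity
    nlinarith)
  linarith

lemma zeta1_growth {s : ℂ} (h : 1 / 4 ≤ s.re) {T : ℝ} (h1 : ‖s‖ ≤ T) (h2 : ‖s - 1‖ ≤ T) (hT : 1 ≤ T) :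
    ‖riemannZeta₁ s‖ ≤ 5 * T ^ 2 := by
  have := zeta1_bound (s := s) (by linarith)
  have h3 : ‖s - 1‖ / s.re ≤ 4 * T := by
    rw [div_le_iff₀ (by linarith)]
    nlinarith
  calc _ ≤ _ := this
    _ ≤ T * (1 + 4 * T) := by gcongr
    _ ≤ _ := by nlinarith

lemma zeta1_lower' {s : ℂ} (hs : 1 < s.re) (hs2 : s.re ≤ 3) :
    (s.re - 1) ^ 2 / 5 ≤ ‖riemannZeta₁ s‖ := by
  refine le_trans ?_ (zeta1_lower hs)
  have h1 : s.re - 1 ≤ ‖s - 1‖ := by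
    have := Complex.re_le_norm (s - 1); simpa using this
  have h2 : (s.re - 1) / 5 ≤ (s.re - 1) / (2 * s.re - 1) := by
    gcongr
    · linarith
    · linarith
  have h3 : 0 ≤ (s.re - 1) / 5 := by linarith
  calc _ = (s.re - 1) * ((s.re - 1) / 5) := by ring
    _ ≤ _ := by gcongr

lemma re_ZD_lower {σ u M : ℝ} (hσ : 1 < σ) (hσ2 : σ ≤ 101 / 100) (hM : 0 < M)
    (hMb : 25 * (|u| + 2) ^ 2 ≤ Real.exp M * (σ - 1) ^ 2) :
    -(9 / 2 * M) ≤ (ZD (σ + u * I)).re ∧ ∀ ρ : ℂ, riemannZeta₁ (σ + u * I + ρ) = 0 → ‖ρ‖ < 3 / 4 →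
      -(9 / 2 * M) + (-ρ.re) * (1 / ‖ρ‖^2 - 16 / 9) ≤ (ZD (σ + u * I)).re := by
  set s0 : ℂ := σ + u * I with hs0
  have hre : s0.re = σ := by simp [s0]
  set f : ℂ → ℂ := fun z => riemannZeta₁ (s0 + z) with hf
  have hfd : Differentiable ℂ f := by
    have := differentiable_riemannZeta₁
    fun_prop
  have hf0 : f 0 = riemannZeta₁ s0 := by simp [f]
  have h0 : f 0 ≠ 0 := by rw [hf0]; exact zeta1_ne_zero_of_one_le (by rw [hre]; linarith)
  have hdf : deriv f 0 / f 0 = ZD s0 := by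
    rw [hf0, ZD]; congr 1
    rw [hf, deriv_comp_const_add]; simp
  have hb : ∀ z, ‖z‖ = 3 / 4 → ‖f z‖ ≤ Real.exp M * ‖f 0‖ := by
    intro z hz
    have hzre := (abs_le.1 (Complex.abs_re_le_norm z))
    have n1 : ‖s0 - 1‖ ≤ |u| + 1 / 100 := by
      have : s0 - 1 = ((σ - 1 : ℝ) : ℂ) + u * I := by simp [s0]; ring
      rw [this]
      refine (norm_add_le _ _).trans ?_
      rw [Complex.norm_real, norm_mul, Complex.norm_real, Complex.norm_I, Real.norm_eq_abs, Real.norm_eq_abs,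
        abs_of_pos (by linarith)]
      linarith
    have n2 : ‖s0 + z - 1‖ ≤ |u| + 1 / 100 + 3 / 4 := by
      rw [show s0 + z - 1 = (s0 - 1) + z by ring]
      refine (norm_add_le _ _).trans ?_
      linarith
    have n3 : ‖s0 + z‖ ≤ |u| + 2 := by
      rw [show s0 + z = (s0 + z - 1) + 1 by ring]
      refine (norm_add_le _ _).trans ?_
      rw [norm_one]
      linarith
    have n4 := zeta1_growth (s := s0 + z) (T := |u| + 2) (by rw [add_re, hre]; linarith) n3 (by linarith)
      (by linarith [abs_nonneg u])
    have n5 := zeta1_lower' (s := s0) (by rw [hre]; exact hσ) (by rw [hre]; linarith)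
    rw [hre] at n5
    rw [hf0]
    have := Real.exp_pos M
    have n6 : Real.exp M * ((σ - 1) ^ 2 / 5) ≤ Real.exp M * ‖riemannZeta₁ s0‖ := by gcongr
    refine n4.trans ?_
    linarith
  have hz : ∀ z, ‖z‖ < 3 / 4 → f z = 0 → z.re ≤ 0 := by
    intro z _ hz
    by_contra hc
    push Not at hc
    exact zeta1_ne_zero_of_one_le (s := s0 + z) (by rw [add_re, hre]; linarith) hz
  refine ⟨?_, ?_⟩
  · have := re_logderiv (R := 3/4) (R' := 1/2) (by norm_num) (by norm_num) hM hfd h0 hb hz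
    rw [hdf] at this
    linarith
  · intro ρ hρ hρn
    have := re_logderiv_zero (R := 3/4) (R' := 1/2) (by norm_num) (by norm_num) hM hfd h0 hb hz (ρ := ρ) hρ hρn
    rw [hdf] at this
    norm_num at this ⊢
    linarith

noncomputable def LL (t : ℝ) : ℝ := Real.log (|t| + 1000)

lemma exp_LL (t : ℝ) : Real.exp (LL t) = |t| + 1000 := Real.exp_log (by positivity)

lemma LL_ge (t : ℝ) : 6 ≤ LL t := by
  unfold LL
  rw [Real.le_log_iff_exp_le (by positivity)]
  have h1 : Real.exp 6 = Real.exp 1 ^ 6 := by rw [← Real.exp_nat_mul]; norm_num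
  have h2 := Real.exp_one_lt_d9
  rw [h1]
  have h3 : Real.exp 1 ^ 6 ≤ 2.72 ^ 6 := by gcongr; linarith
  have h4 := abs_nonneg t
  norm_num at h3 ⊢; linarith

lemma LL_le (t : ℝ) : LL t ≤ 7 * ((|t| + 1000) / 1000) := by
  have h1 : Real.exp 7 = Real.exp 1 ^ 7 := by rw [← Real.exp_nat_mul]; norm_num
  have h2 := Real.exp_one_gt_d9
  have h3 : Real.log 1000 ≤ 7 := by
    rw [Real.log_le_iff_le_exp (by norm_num), h1]
    have : (2.718:ℝ) ^ 7 ≤ Real.exp 1 ^ 7 := by gcongr; linarith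
    norm_num at *; linarith
  have h4 : LL t = Real.log ((|t| + 1000) / 1000) + Real.log 1000 := by
    rw [LL, Real.log_div (by positivity) (by norm_num)]; ring
  have h5 := Real.log_le_sub_one_of_pos (x := (|t| + 1000) / 1000) (by positivity)
  have := abs_nonneg t
  linarith

lemma M_bound {t u η : ℝ} (hu : |u| ≤ 2 * |t|) (hη : η = 1 / (1000 * LL t)) :
    25 * (|u| + 2) ^ 2 ≤ Real.exp (6 * LL t) * η ^ 2 := by
  have h1 := LL_ge t
  have h2 := LL_le t
  have h3 : Real.exp (6 * LL t) = (|t| + 1000) ^ 6 := by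
    rw [← exp_LL, ← Real.exp_nat_mul]; norm_num
  set T := |t| + 1000 with hT
  have hT' : 1000 ≤ T := by have := abs_nonneg t; linarith
  have h4 : |u| + 2 ≤ 2 * T := by linarith
  rw [h3, hη, div_pow, one_pow, mul_one_div, le_div_iff₀ (by positivity)]
  have h5 : LL t ^ 2 ≤ (7 * (T / 1000)) ^ 2 := by gcongr
  have h6 : (|u| + 2) ^ 2 ≤ (2 * T) ^ 2 := by gcongr
  calc 25 * (|u| + 2) ^ 2 * (1000 * LL t) ^ 2 = 25 * 10 ^ 6 * ((|u| + 2) ^ 2 * LL t ^ 2) := by ring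
    _ ≤ 25 * 10 ^ 6 * ((2 * T) ^ 2 * (7 * (T / 1000)) ^ 2) := by gcongr
    _ = 4900 * T ^ 4 := by ring
    _ ≤ T ^ 2 * T ^ 4 := by gcongr; nlinarith
    _ = _ := by ring

lemma re_inv_le {η t : ℝ} (hη : 0 < η) (ht : 1 / 2 ≤ |t|) :
    (1 / (((1 + η : ℝ):ℂ) + t * I - 1)).re ≤ 4 * η := by
  have e : ((1 + η : ℝ):ℂ) + t * I - 1 = η + t * I := by push_cast; ring
  rw [e, one_div, Complex.inv_re]
  have : Complex.normSq (η + t * I) = η ^ 2 + t ^ 2 := by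
    rw [Complex.normSq_apply]; simp; ring
  rw [this]
  have ht2 : 1 / 4 ≤ t ^ 2 := by rw [← sq_abs]; nlinarith
  simp
  rw [div_le_iff₀ (by positivity)]
  nlinarith [sq_nonneg η]

lemma zero_free {ρ : ℂ} (h : riemannZeta₁ ρ = 0) : ρ.re ≤ 1 - 1 / (5000 * LL ρ.im) := by
  by_contra hc
  push Not at hc
  set t := ρ.im with ht
  set L := LL t with hL
  have hL6 : 6 ≤ L := LL_ge t
  have hβ : ρ.re < 1 := by
    by_contra h1
    exact zeta1_ne_zero_of_one_le (not_lt.1 h1) h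
  have hsm : 1 / (5000 * L) ≤ 1 / 30000 := one_div_le_one_div_of_le (by norm_num) (by linarith)
  by_cases hth : |t| < 1 / 2
  · refine zeta1_ne_zero_near (s := ρ) ?_ h
    have h1 := Complex.norm_le_abs_re_add_abs_im (ρ - 1)
    simp only [sub_re, one_re, sub_im, one_im, sub_zero] at h1
    rw [abs_of_neg (by linarith : ρ.re - 1 < 0)] at h1
    linarith
  · push Not at hth
    set η := 1 / (1000 * L) with hη
    have hη0 : 0 < η := by positivity
    have hηs : η ≤ 1 / 6000 := one_div_le_one_div_of_le (by norm_num) (by linarith)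
    have h341 := three_four_one (σ := 1 + η) (by linarith) t
    have i1 := re_inv_le hη0 hth
    have i2 := re_inv_le (t := 2 * t) hη0 (by rw [abs_mul]; norm_num; linarith)
    have i3 : (1 / (((1 + η : ℝ):ℂ) + (0:ℝ) * I - 1)).re = 1 / η := by
      have : ((1 + η : ℝ):ℂ) + (0:ℝ) * I - 1 = (η:ℂ) := by push_cast; ring
      rw [this, ← Complex.ofReal_one, ← Complex.ofReal_div, Complex.ofReal_re]
    have hM : 0 < 6 * L := by positivity
    have heq : (1 + η) - 1 = 1 / (1000 * LL t) := by rw [hη]; ring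
    obtain ⟨a1, -⟩ := re_ZD_lower (σ := 1 + η) (u := 0) (by linarith) (by linarith) hM
      (M_bound (by simp) heq)
    obtain ⟨a2, -⟩ := re_ZD_lower (σ := 1 + η) (u := 2 * t) (by linarith) (by linarith) hM
      (M_bound (by rw [abs_mul]; norm_num) heq)
    obtain ⟨-, a3⟩ := re_ZD_lower (σ := 1 + η) (u := t) (by linarith) (by linarith) hM
      (M_bound (by linarith [abs_nonneg t]) heq)
    set v : ℝ := 1 + η - ρ.re with hv
    have hv0 : 0 < v := by linarith
    have hvs : v ≤ 1 / 4000 := by linarith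
    have hpt : (((1 + η : ℝ):ℂ) + t * I + ((-v : ℝ) : ℂ)) = ρ := by
      apply Complex.ext <;> simp [hv, ht]
    have a4 := a3 ((-v : ℝ) : ℂ) (by rw [hpt]; exact h) (by
      rw [Complex.norm_real, Real.norm_eq_abs, abs_neg, abs_of_pos hv0]; linarith)
    rw [Complex.norm_real, Real.norm_eq_abs, abs_neg, abs_of_pos hv0, Complex.ofReal_re, neg_neg] at a4
    have e1 : v * (1 / v ^ 2 - 16 / 9) = 1 / v - 16 / 9 * v := by field_simp
    rw [e1] at a4
    rw [i3] at h341
    have e2 : 1 / η = 1000 * L := by rw [hη]; field_simp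
    rw [e2] at h341
    have hkey : 4 * (1 / v) ≤ 3000 * L + 20 * η + 216 * L + 8 * v := by linarith
    have hvub : v < 6 / (5000 * L) := by
      have : η = 5 / (5000 * L) := by rw [hη]; field_simp; norm_num
      have h6 : 6 / (5000 * L) = 5 / (5000 * L) + 1 / (5000 * L) := by ring
      rw [h6, ← this]
      linarith
    have hvl : 5000 * L / 6 < 1 / v := by
      rw [lt_div_iff₀ hv0]
      rw [lt_div_iff₀ (by positivity)] at hvub
      linarith
    linarith

end TC

namespace TC
open Complex MeasureTheory Set Filter Topology Asymptotics Metric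

lemma LL_shift {t u : ℝ} (h : |u - t| ≤ 1) : LL u ≤ 2 * LL t := by
  have h1 : |u| ≤ |t| + 1 := by
    have := abs_sub_abs_le_abs_sub u t; linarith
  have h2 : |u| + 1000 ≤ (|t| + 1000) ^ 2 := by nlinarith [abs_nonneg t]
  unfold LL
  rw [show (2:ℝ) * Real.log (|t| + 1000) = Real.log ((|t| + 1000) ^ 2) by rw [Real.log_pow]; norm_num]
  exact Real.log_le_log (by positivity) h2

noncomputable def dd (t : ℝ) : ℝ := 1 / (20000 * LL t)

lemma dd_pos (t : ℝ) : 0 < dd t := by have := LL_ge t; unfold dd; positivity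

lemma dd_le (t : ℝ) : dd t ≤ 1 / 120000 :=
  one_div_le_one_div_of_le (by norm_num) (by have := LL_ge t; linarith)

lemma M_bound2 (t : ℝ) : 25 * (|t| + 4) ^ 2 ≤ Real.exp (6 * LL t) * dd t ^ 2 := by
  have h1 := LL_ge t
  have h2 := LL_le t
  have h3 : Real.exp (6 * LL t) = (|t| + 1000) ^ 6 := by
    rw [← exp_LL, ← Real.exp_nat_mul]; norm_num
  set T := |t| + 1000 with hT
  have hT' : 1000 ≤ T := by have := abs_nonneg t; linarith
  have h4 : |t| + 4 ≤ T := by linarith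
  rw [h3, dd, div_pow, one_pow, mul_one_div, le_div_iff₀ (by positivity)]
  have h5 : LL t ^ 2 ≤ (7 * (T / 1000)) ^ 2 := by gcongr
  have h6 : (|t| + 4) ^ 2 ≤ T ^ 2 := by gcongr
  calc 25 * (|t| + 4) ^ 2 * (20000 * LL t) ^ 2 = 25 * (4 * 10 ^ 8) * ((|t| + 4) ^ 2 * LL t ^ 2) := by ring
    _ ≤ 25 * (4 * 10 ^ 8) * (T ^ 2 * (7 * (T / 1000)) ^ 2) := by gcongr
    _ = 490000 * T ^ 4 := by ring
    _ ≤ T ^ 2 * T ^ 4 := by gcongr; nlinarith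
    _ = _ := by ring

lemma ZD_bound {σ t : ℝ} (hσ : 1 < σ) (hσ2 : σ ≤ 2) {s : ℂ} (hs : ‖s - (σ + t * I)‖ ≤ dd t) :
    riemannZeta₁ s ≠ 0 ∧ ‖ZD s‖ ≤ 2400000 * LL t ^ 2 := by
  have hd := dd_pos t
  have hd2 := dd_le t
  set d := dd t with hdd
  have hL := LL_ge t
  set s0 : ℂ := ((σ + d : ℝ) : ℂ) + t * I with hs0
  have hre : s0.re = σ + d := by simp [s0]
  have him : s0.im = t := by simp [s0]
  set f : ℂ → ℂ := fun z => riemannZeta₁ (s0 + z) with hf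
  have hfd : Differentiable ℂ f := by
    have := differentiable_riemannZeta₁
    fun_prop
  have hne : ∀ z : ℂ, ‖z‖ < 3 * d → f z ≠ 0 := by
    intro z hz h0
    have h1 := zero_free h0
    have hzre := (abs_le.1 (Complex.abs_re_le_norm z)).1
    have hzim := Complex.abs_im_le_norm z
    have h2 : LL (s0 + z).im ≤ 2 * LL t := LL_shift (by rw [add_im, him]; simp; linarith)
    have h3 : 1 / (5000 * (2 * LL t)) ≤ 1 / (5000 * LL (s0 + z).im) := by
      have := LL_ge (s0 + z).im
      gcongr
    have h4 : 1 / (5000 * (2 * LL t)) = 2 * d := by rw [hdd, dd]; field_simp; norm_num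
    rw [add_re, hre] at h1
    linarith
  have hb : ∀ z : ℂ, ‖z‖ < 3 * d → ‖f z‖ ≤ Real.exp (6 * LL t) * ‖f 0‖ := by
    intro z hz
    have hzre := (abs_le.1 (Complex.abs_re_le_norm z)).1
    have n1 : ‖s0 - 1‖ ≤ |t| + 1 + d := by
      have : s0 - 1 = ((σ + d - 1 : ℝ) : ℂ) + t * I := by simp [s0]; ring
      rw [this]
      refine (norm_add_le _ _).trans ?_
      rw [Complex.norm_real, norm_mul, Complex.norm_real, Complex.norm_I, Real.norm_eq_abs, Real.norm_eq_abs,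
        abs_of_pos (by linarith)]
      linarith
    have n2 : ‖s0 + z - 1‖ ≤ |t| + 2 := by
      rw [show s0 + z - 1 = (s0 - 1) + z by ring]
      refine (norm_add_le _ _).trans ?_
      linarith
    have n3 : ‖s0 + z‖ ≤ |t| + 3 := by
      rw [show s0 + z = (s0 + z - 1) + 1 by ring]
      refine (norm_add_le _ _).trans ?_
      rw [norm_one]
      linarith
    have n4 := zeta1_growth (s := s0 + z) (T := |t| + 4) (by rw [add_re, hre]; linarith) (by linarith) (by linarith)
      (by linarith [abs_nonneg t])
    have n5 := zeta1_lower' (s := s0) (by rw [hre]; linarith) (by rw [hre]; linarith)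
    rw [hre] at n5
    have n6 : d ^ 2 / 5 ≤ ‖f 0‖ := by
      have e : f 0 = riemannZeta₁ s0 := by simp [f]
      rw [e]
      refine le_trans ?_ n5
      gcongr; linarith
    have := Real.exp_pos (6 * LL t)
    have n7 : Real.exp (6 * LL t) * (d ^ 2 / 5) ≤ Real.exp (6 * LL t) * ‖f 0‖ := by gcongr
    have n8 := M_bound2 t
    refine n4.trans ?_
    linarith
  have hw : ‖s - s0‖ ≤ 2 * d := by
    have e : s - s0 = (s - (σ + t * I)) + ((-d : ℝ):ℂ) := by simp [s0]; ring
    rw [e]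
    refine (norm_add_le _ _).trans ?_
    rw [Complex.norm_real, Real.norm_eq_abs, abs_neg, abs_of_pos hd]
    linarith
  refine ⟨?_, ?_⟩
  · have := hne (s - s0) (by linarith)
    simpa [f] using this
  · have := logderiv_bound hfd (R := 3 * d) (M := 6 * LL t) (by linarith) (by linarith) hne hb (w := s - s0)
      (by linarith)
    have e : deriv f (s - s0) / f (s - s0) = ZD s := by
      rw [ZD, hf, deriv_comp_const_add]; simp
    rw [e] at this
    refine this.trans (le_of_eq ?_)
    rw [hdd, dd]; field_simp; norm_num

noncomputable def HH (s : ℂ) : ℂ := (- ZD s - 1) / (s * (s + 1))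

/-- The function in Mellin coordinates `w = -(s+1)`. -/
noncomputable def GG (w : ℂ) : ℂ := HH (-1 - w)

lemma HH_diff {s : ℂ} (hs : 0 < s.re) (h : riemannZeta₁ s ≠ 0) : DifferentiableAt ℂ HH s := by
  have h1 : DifferentiableAt ℂ (deriv riemannZeta₁) s :=
    (differentiable_riemannZeta₁.analyticAt s).deriv.differentiableAt
  have h2 : s ≠ 0 := by rintro rfl; simp at hs
  have h3 : s + 1 ≠ 0 := by
    intro h; have := congrArg Complex.re h; simp at this; linarith
  unfold HH ZD
  have h4 := differentiable_riemannZeta₁ s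
  have h5 := mul_ne_zero h2 h3
  fun_prop (disch := assumption)

lemma GG_diff {w : ℂ} (hs : 0 < (-1-w).re) (h : riemannZeta₁ (-1-w) ≠ 0) : DifferentiableAt ℂ GG w := by
  have := HH_diff hs h
  exact DifferentiableAt.comp w this (by fun_prop)

lemma LL_pow_le (t : ℝ) : LL t ^ 12 ≤ 24 ^ 12 * (32 * (1 + |t|) ^ (1 / 2 : ℝ)) := by
  have h0 : (0:ℝ) < |t| + 1000 := by positivity
  have h1 : LL t ≤ 24 * (|t| + 1000) ^ (1 / 24 : ℝ) := by
    have := Real.log_le_rpow_div (x := |t| + 1000) h0.le (ε := 1 / 24) (by norm_num)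
    unfold LL; linarith
  have h2 : LL t ^ 12 ≤ (24 * (|t| + 1000) ^ (1 / 24 : ℝ)) ^ 12 := by
    have := LL_ge t
    gcongr
  refine h2.trans ?_
  rw [mul_pow, ← Real.rpow_natCast ((|t| + 1000) ^ (1 / 24 : ℝ)) 12, ← Real.rpow_mul h0.le]
  norm_num only
  have h3 : (|t| + 1000) ^ (1 / 2 : ℝ) ≤ 32 * (1 + |t|) ^ (1 / 2 : ℝ) := by
    rw [← Real.sqrt_eq_rpow, ← Real.sqrt_eq_rpow]
    rw [show (32:ℝ) = Real.sqrt (32 ^ 2) by rw [Real.sqrt_sq]; norm_num, ← Real.sqrt_mul (by norm_num)]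
    apply Real.sqrt_le_sqrt
    nlinarith [abs_nonneg t]
  gcongr

lemma inv_le (t : ℝ) : 1 / (1 + t ^ 2) ≤ 2 * (1 + |t|) ^ (-2 : ℝ) := by
  have h0 : (0:ℝ) < 1 + |t| := by positivity
  rw [Real.rpow_neg h0.le, ← one_div, mul_one_div]
  rw [show ((2:ℝ)) = ((2:ℕ):ℝ) by norm_num, Real.rpow_natCast]
  rw [div_le_div_iff₀ (by positivity) (by positivity)]
  have := sq_abs t
  push_cast
  nlinarith [sq_nonneg (|t| - 1)]

lemma GG_bound {σ t : ℝ} (hσ : 1 < σ) (hσ2 : σ ≤ 2) :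
    ‖iteratedDeriv 10 GG (((-1 - σ : ℝ) : ℂ) + t * I)‖ ≤ 3 * 10 ^ 74 * (1 + |t|) ^ (-(3 / 2) : ℝ) := by
  have hd := dd_pos t
  have hd2 := dd_le t
  have hL := LL_ge t
  set c : ℂ := ((-1 - σ : ℝ) : ℂ) + t * I with hc
  have hdd' : dd (-t) = dd t := by simp [dd, LL]
  have hLL' : LL (-t) = LL t := by simp [LL]
  have hpt : ∀ z ∈ closedBall c (dd t), ‖(-1 - z) - ((σ:ℂ) + (-t : ℝ) * I)‖ ≤ dd (-t) := by
    intro z hz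
    rw [hdd']
    have : (-1 - z) - ((σ:ℂ) + (-t : ℝ) * I) = - (z - c) := by simp [c]; ring
    rw [this, norm_neg]
    simpa [dist_eq_norm] using hz
  have hre : ∀ z ∈ closedBall c (dd t), 0 < (-1 - z).re := by
    intro z hz
    have h1 := (abs_le.1 ((Complex.abs_re_le_norm _).trans (hpt z hz))).1
    simp at h1 ⊢
    rw [hdd'] at h1
    linarith
  have hdc : DiffContOnCl ℂ GG (ball c (dd t)) := by
    refine DifferentiableOn.diffContOnCl (fun z hz => ?_)
    rw [closure_ball _ hd.ne'] at hz
    exact (GG_diff (hre z hz) (ZD_bound hσ hσ2 (hpt z hz)).1).differentiableWithinAt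
  have hbd : ∀ z ∈ sphere c (dd t), ‖GG z‖ ≤ 3000000 * LL t ^ 2 / (1 + t ^ 2) := by
    intro z hz'
    have hz := sphere_subset_closedBall hz'
    have h1 := (ZD_bound hσ hσ2 (hpt z hz)).2
    have h2 := hpt z hz
    have h3 := hre z hz
    rw [hLL'] at h1
    rw [hdd'] at h2
    set s := -1 - z with hs
    have h4 : Real.sqrt (1 + t ^ 2) ≤ ‖(σ:ℂ) + (-t : ℝ) * I‖ := by
      rw [Complex.norm_def]
      apply Real.sqrt_le_sqrt
      rw [Complex.normSq_apply]; simp; nlinarith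
    have h5 : 1 ≤ Real.sqrt (1 + t ^ 2) := by
      rw [Real.one_le_sqrt]; nlinarith [sq_nonneg t]
    have h6 : Real.sqrt (1 + t ^ 2) - dd t ≤ ‖s‖ := by
      have := norm_sub_norm_le ((σ:ℂ) + (-t : ℝ) * I) s
      rw [norm_sub_rev ((σ:ℂ) + (-t : ℝ) * I) s] at this
      linarith
    have h7 : 0.99 * Real.sqrt (1 + t ^ 2) ≤ ‖s‖ := by
      norm_num; linarith
    have h8 : ‖s‖ ≤ ‖s + 1‖ := by
      rw [Complex.norm_def, Complex.norm_def]
      apply Real.sqrt_le_sqrt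
      rw [Complex.normSq_apply, Complex.normSq_apply]; simp; nlinarith
    have h9 : 0.98 * (1 + t ^ 2) ≤ ‖s‖ * ‖s + 1‖ := by
      have e : Real.sqrt (1 + t ^ 2) * Real.sqrt (1 + t ^ 2) = 1 + t ^ 2 :=
        Real.mul_self_sqrt (by positivity)
      calc 0.98 * (1 + t ^ 2) ≤ (0.99 * Real.sqrt (1 + t ^ 2)) * (0.99 * Real.sqrt (1 + t ^ 2)) := by
            nlinarith [sq_nonneg t]
        _ ≤ _ := by gcongr; linarith
    show ‖HH s‖ ≤ _
    rw [HH, norm_div, norm_mul]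
    have h10 : ‖- ZD s - 1‖ ≤ 2400000 * LL t ^ 2 + 1 := by
      refine (norm_sub_le _ _).trans ?_
      rw [norm_neg, norm_one]; linarith
    have hp : 0 < 1 + t ^ 2 := by positivity
    rw [div_le_div_iff₀ (by linarith) hp]
    have h11 : ‖- ZD s - 1‖ ≤ 3000000 * LL t ^ 2 * 0.98 := by nlinarith
    calc _ ≤ 3000000 * LL t ^ 2 * 0.98 * (1 + t ^ 2) := by gcongr
      _ = 3000000 * LL t ^ 2 * (0.98 * (1 + t ^ 2)) := by ring
      _ ≤ _ := by gcongr
  have hfin := norm_iteratedDeriv_le_of_forall_mem_sphere_norm_le 10 hd hdc hbd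
  refine hfin.trans ?_
  have e1 : ((10).factorial : ℝ) = 3628800 := by norm_num [Nat.factorial]
  have e2 : ((10).factorial : ℝ) * (3000000 * LL t ^ 2 / (1 + t ^ 2)) / dd t ^ 10 =
     3628800 * 3000000 * 20000 ^ 10 * (LL t ^ 12 * (1 / (1 + t ^ 2))) := by
    rw [e1, dd]; field_simp
  rw [e2]
  have h0 : (0:ℝ) < 1 + |t| := by positivity
  have e3 : (1 + |t|) ^ (1 / 2 : ℝ) * (1 + |t|) ^ (-2 : ℝ) = (1 + |t|) ^ (-(3 / 2) : ℝ) := by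
    rw [← Real.rpow_add h0]; norm_num
  calc _ ≤ 3628800 * 3000000 * 20000 ^ 10 * ((24 ^ 12 * (32 * (1 + |t|) ^ (1 / 2 : ℝ))) * (2 * (1 + |t|) ^ (-2 : ℝ))) := by
        gcongr
        · exact LL_pow_le t
        · exact inv_le t
    _ = 3628800 * 3000000 * 20000 ^ 10 * 24 ^ 12 * 32 * 2 * ((1 + |t|) ^ (1 / 2 : ℝ) * (1 + |t|) ^ (-2 : ℝ)) := by ring
    _ ≤ _ := by
      rw [e3]
      refine mul_le_mul_of_nonneg_right ?_ (by positivity)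
      norm_num

end TC

namespace TC
open Complex MeasureTheory Set Filter Topology Asymptotics Metric

noncomputable def EE (u : ℝ) : ℝ := indicator (Ioi 1) (fun u => Chebyshev.psi u - u) u

noncomputable def AA (x : ℝ) : ℝ := ∫ u in (1:ℝ)..x, EE u

lemma EE_of_gt {u : ℝ} (h : 1 < u) : EE u = Chebyshev.psi u - u := by
  unfold EE; rw [indicator_of_mem]; exact h

lemma measurable_EE : Measurable EE := by
  unfold EE
  exact (Chebyshev.psi_mono.measurable.sub measurable_id).indicator measurableSet_Ioi

lemma psi_le_six {u : ℝ} (h : 0 ≤ u) : Chebyshev.psi u ≤ 6 * u := by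
  have h1 := Chebyshev.psi_le_const_mul_self h
  have h2 : Real.log 4 ≤ 2 := by
    have := Real.log_two_lt_d9
    rw [show (4:ℝ) = 2 ^ 2 by norm_num, Real.log_pow]; push_cast; linarith
  nlinarith

lemma abs_EE_le (u : ℝ) : |EE u| ≤ 6 * |u| := by
  by_cases h : 1 < u
  · rw [EE_of_gt h, abs_of_pos (by linarith : 0 < u), abs_le]
    have := psi_le_six (u := u) (by linarith)
    have := Chebyshev.psi_nonneg u
    constructor <;> linarith
  · unfold EE; rw [indicator_of_notMem (by simpa using h)]; simp

lemma intervalIntegrable_EE (a b : ℝ) : IntervalIntegrable EE volume a b := by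
  have h1 : IntervalIntegrable (fun u : ℝ => 6 * |u|) volume a b :=
    (by fun_prop : Continuous fun u : ℝ => 6 * |u|).intervalIntegrable a b
  refine h1.mono_fun measurable_EE.aestronglyMeasurable ?_
  refine ae_of_all _ fun u => ?_
  beta_reduce
  rw [Real.norm_eq_abs, Real.norm_eq_abs, abs_of_nonneg (by positivity : 0 ≤ 6 * |u|)]
  exact abs_EE_le u

lemma continuous_AA : Continuous AA :=
  intervalIntegral.continuous_primitive intervalIntegrable_EE 1

lemma AA_zero {x : ℝ} (hx : x ≤ 1) : AA x = 0 := by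
  unfold AA
  rw [intervalIntegral.integral_symm, neg_eq_zero]
  rw [intervalIntegral.integral_congr (g := fun _ => 0)]
  · simp
  · intro u hu
    rw [uIcc_of_le hx] at hu
    unfold EE; rw [indicator_of_notMem]; simpa using hu.2

lemma abs_AA_le {x : ℝ} (hx : 1 ≤ x) : |AA x| ≤ 6 * x ^ 2 := by
  have := intervalIntegral.norm_integral_le_of_norm_le_const (f := EE) (a := 1) (b := x) (C := 6 * x) (by
    intro u hu
    rw [uIoc_of_le hx] at hu
    refine (abs_EE_le u).trans ?_
    rw [abs_of_pos (by linarith [hu.1])]; linarith [hu.2])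
  rw [Real.norm_eq_abs, abs_of_nonneg (by linarith : 0 ≤ x - 1)] at this
  unfold AA
  nlinarith

lemma EE_right_cont {x : ℝ} (hx : 1 < x) : ContinuousWithinAt EE (Ioi x) x := by
  have h1 : ContinuousWithinAt (fun u => Chebyshev.psi x - u) (Ioi x) x := by fun_prop
  refine h1.congr_of_eventuallyEq ?_ (EE_of_gt hx)
  have h2 : Ioo x (⌊x⌋₊ + 1) ∈ 𝓝[>] x := Ioo_mem_nhdsGT (Nat.lt_floor_add_one x)
  filter_upwards [h2] with u hu
  rw [EE_of_gt (hx.trans hu.1)]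
  have : ⌊u⌋₊ = ⌊x⌋₊ := by
    rw [Nat.floor_eq_iff (by linarith [hu.1])]
    exact ⟨(Nat.floor_le (by linarith)).trans hu.1.le, hu.2⟩
  unfold Chebyshev.psi
  rw [this]

lemma AA_right_deriv {x : ℝ} (hx : 1 < x) : HasDerivWithinAt AA (EE x) (Ioi x) x := by
  have h : HasDerivWithinAt AA (EE x) (Ici x) x :=
    intervalIntegral.integral_hasDerivWithinAt_right (t := Ioi x) (intervalIntegrable_EE 1 x)
      (measurable_EE.stronglyMeasurable.stronglyMeasurableAtFilter) (EE_right_cont hx)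
  exact h.mono Ioi_subset_Ici_self

lemma integrable_EE_cpow {s : ℂ} (hs : 1 < s.re) :
    IntegrableOn (fun u : ℝ => ((EE u : ℝ):ℂ) * (u:ℂ) ^ (-s - 1)) (Ioi 1) := by
  have h3 : IntegrableOn (fun u : ℝ => 6 * u ^ (-s.re)) (Ioi 1) :=
    (integrableOn_Ioi_rpow_of_lt (by linarith) one_pos).const_mul 6
  refine h3.mono' ?_ ?_
  · refine AEStronglyMeasurable.mul (Complex.measurable_ofReal.comp measurable_EE).aestronglyMeasurable ?_
    exact (integrableOn_Ioi_cpow_of_lt (by simp; linarith) one_pos).aestronglyMeasurable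
  · refine (ae_restrict_iff' measurableSet_Ioi).2 (ae_of_all _ fun u hu => ?_)
    have hu' : (0:ℝ) < u := lt_trans one_pos hu
    rw [norm_mul, Complex.norm_real, Real.norm_eq_abs, Complex.norm_cpow_eq_rpow_re_of_pos hu']
    simp only [sub_re, neg_re, one_re]
    rw [Real.rpow_sub_one hu'.ne']
    have h1 := abs_EE_le u
    rw [abs_of_pos hu'] at h1
    have h2 : 0 < u ^ (-s.re) / u := by positivity
    calc |EE u| * (u ^ (-s.re) / u) ≤ (6 * u) * (u ^ (-s.re) / u) := by gcongr
      _ = _ := by field_simp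

lemma integral_EE {s : ℂ} (hs : 1 < s.re) :
    ∫ u in Ioi (1:ℝ), ((EE u : ℝ):ℂ) * (u:ℂ) ^ (-s - 1) = (- ZD s - 1) / s := by
  have hs1 : s ≠ 1 := by rintro rfl; simp at hs
  have hs1' : s - 1 ≠ 0 := sub_ne_zero.2 hs1
  have hs0 : s ≠ 0 := by rintro rfl; simp at hs; linarith
  have hpsi : ∀ u : ℝ, Chebyshev.psi u = ∑ k ∈ Finset.Icc 1 ⌊u⌋₊, ArithmeticFunction.vonMangoldt k := by
    intro u; unfold Chebyshev.psi
    rfl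
  have h1 := LSeries_eq_mul_integral_of_nonneg (fun n => ArithmeticFunction.vonMangoldt n) (r := 1) zero_le_one hs
    (by
      refine IsBigO.of_bound 6 (Eventually.of_forall fun n => ?_)
      have h2 := hpsi n
      rw [Nat.floor_natCast] at h2
      rw [← h2, Real.rpow_one, Real.norm_eq_abs, abs_of_nonneg (Chebyshev.psi_nonneg _), Real.norm_eq_abs,
        abs_of_nonneg (Nat.cast_nonneg n)]
      exact psi_le_six (Nat.cast_nonneg n)) (fun _ => ArithmeticFunction.vonMangoldt_nonneg)
  have h2 := LSeries_vM hs
  unfold vM at h2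
  rw [h2] at h1
  have hI : IntegrableOn (fun u : ℝ => (u:ℂ) ^ (-s)) (Ioi 1) :=
    integrableOn_Ioi_cpow_of_lt (by simpa using hs) one_pos
  have h4 : ∫ u in Ioi (1:ℝ), (u:ℂ) ^ (-s) = 1 / (s - 1) := by
    rw [integral_Ioi_cpow_of_lt (by simpa using hs) one_pos]
    simp
    rw [show -s + 1 = - (s - 1) by ring, neg_div_neg_eq, one_div]
  have h3 : (∫ t in Ioi (1 : ℝ), (∑ k ∈ Finset.Icc 1 ⌊t⌋₊, ((ArithmeticFunction.vonMangoldt k : ℝ):ℂ)) * (t:ℂ) ^ (-(s + 1)))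
     = (∫ u in Ioi (1:ℝ), ((EE u : ℝ):ℂ) * (u:ℂ) ^ (-s - 1)) + 1 / (s - 1) := by
    rw [← h4, ← integral_add (integrable_EE_cpow hs) hI]
    refine setIntegral_congr_fun measurableSet_Ioi fun u hu => ?_
    have hu' : (0:ℝ) < u := lt_trans one_pos hu
    have hu0 : (u:ℂ) ≠ 0 := by exact_mod_cast hu'.ne'
    rw [← Complex.ofReal_sum, ← hpsi u, EE_of_gt hu, show -(s+1) = -s - 1 by ring,
      Complex.cpow_sub _ _ hu0, Complex.cpow_one]
    push_cast
    field_simp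
    ring
  rw [h3] at h1
  generalize (∫ u in Ioi (1:ℝ), ((EE u : ℝ):ℂ) * (u:ℂ) ^ (-s - 1)) = J at h1 ⊢
  rw [eq_div_iff hs0]
  have h5 : J * s = (1 / (s - 1) - ZD s) - s * (1 / (s-1)) := by rw [h1]; ring
  rw [h5]
  field_simp
  ring

lemma integrable_AA_cpow {s : ℂ} (hs : 1 < s.re) :
    IntegrableOn (fun u : ℝ => ((AA u : ℝ):ℂ) * (u:ℂ) ^ (-s - 2)) (Ioi 1) := by
  have h3 : IntegrableOn (fun u : ℝ => 6 * u ^ (-s.re)) (Ioi 1) :=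
    (integrableOn_Ioi_rpow_of_lt (by linarith) one_pos).const_mul 6
  refine h3.mono' ?_ ?_
  · refine AEStronglyMeasurable.mul (Complex.continuous_ofReal.comp continuous_AA).aestronglyMeasurable ?_
    exact (integrableOn_Ioi_cpow_of_lt (by simp; linarith) one_pos).aestronglyMeasurable
  · refine (ae_restrict_iff' measurableSet_Ioi).2 (ae_of_all _ fun u hu => ?_)
    have hu1 : (1:ℝ) < u := hu
    have hu' : (0:ℝ) < u := lt_trans one_pos hu
    rw [norm_mul, Complex.norm_real, Real.norm_eq_abs, Complex.norm_cpow_eq_rpow_re_of_pos hu']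
    simp only [sub_re, neg_re, re_ofNat]
    rw [Real.rpow_sub hu']
    have h1 := abs_AA_le hu1.le
    have h2 : 0 < u ^ (-s.re) / u ^ (2:ℝ) := by positivity
    calc |AA u| * (u ^ (-s.re) / u ^ (2:ℝ)) ≤ (6 * u ^ 2) * (u ^ (-s.re) / u ^ (2:ℝ)) := by gcongr
      _ = _ := by rw [Real.rpow_two]; field_simp

lemma integral_AA {s : ℂ} (hs : 1 < s.re) :
    ∫ u in Ioi (1:ℝ), ((AA u : ℝ):ℂ) * (u:ℂ) ^ (-s - 2) = HH s := by
  have hs0 : s ≠ 0 := by rintro rfl; simp at hs; linarith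
  have hs2 : s + 1 ≠ 0 := by
    intro h; have := congrArg Complex.re h; simp at this; linarith
  have hs3 : -s - 1 ≠ 0 := by
    intro h; apply hs2; linear_combination -h
  set F : ℝ → ℂ := fun x => (AA x : ℂ) * (x:ℂ) ^ (-s - 1)
  have hFT : ∀ T : ℝ, 1 ≤ T → ∫ u in (1:ℝ)..T, (((EE u : ℝ):ℂ) * (u:ℂ) ^ (-s - 1) +
      (-s - 1) * (((AA u : ℝ):ℂ) * (u:ℂ) ^ (-s - 2))) = F T := by
    intro T hT
    have hF1 : F 1 = 0 := by simp [F, AA_zero le_rfl]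
    have key := intervalIntegral.integral_eq_sub_of_hasDeriv_right (a := 1) (b := T) (f := F)
      (f' := fun u => ((EE u : ℝ):ℂ) * (u:ℂ) ^ (-s - 1) + (-s - 1) * (((AA u : ℝ):ℂ) * (u:ℂ) ^ (-s - 2))) ?_ ?_ ?_
    · rw [key, hF1, sub_zero]
    · refine ContinuousOn.mul (Complex.continuous_ofReal.comp continuous_AA).continuousOn ?_
      intro u hu
      rw [uIcc_of_le hT] at hu
      have : (u:ℂ) ∈ slitPlane := Or.inl (by simpa using lt_of_lt_of_le one_pos hu.1)
      refine ContinuousAt.continuousWithinAt ?_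
      exact (continuousAt_cpow_const this).comp Complex.continuous_ofReal.continuousAt
    · intro x hx
      rw [min_eq_left hT, max_eq_right hT] at hx
      have hx0 : 0 < x := by linarith [hx.1]
      have d1 : HasDerivWithinAt (fun x : ℝ => (AA x : ℂ)) (EE x : ℂ) (Ioi x) x :=
        (AA_right_deriv hx.1).ofReal_comp
      have d2 : HasDerivAt (fun x : ℝ => (x:ℂ) ^ (-s - 1)) ((-s - 1) * (x:ℂ) ^ (-s - 1 - 1)) x :=
        hasDerivAt_ofReal_cpow_const hx0.ne' hs3 |>.congr_deriv (by ring)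
      have := d1.mul d2.hasDerivWithinAt
      refine this.congr_deriv ?_
      rw [show -s - 1 - 1 = -s - 2 by ring]; ring
    · rw [intervalIntegrable_iff_integrableOn_Ioc_of_le hT]
      exact ((integrable_EE_cpow hs).mono_set Ioc_subset_Ioi_self).add
        (((integrable_AA_cpow hs).mono_set Ioc_subset_Ioi_self).const_mul _)
  have hlim : Tendsto F atTop (𝓝 0) := by
    have h1 : Tendsto (fun x : ℝ => 6 * x ^ (-(s.re - 1))) atTop (𝓝 0) := by
      have := (tendsto_rpow_neg_atTop (y := s.re - 1) (by linarith)).const_mul 6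
      simpa using this
    refine squeeze_zero_norm' ?_ h1
    filter_upwards [eventually_ge_atTop 1] with u hu
    have hu' : (0:ℝ) < u := by linarith
    simp only [F]
    rw [norm_mul, Complex.norm_real, Real.norm_eq_abs, Complex.norm_cpow_eq_rpow_re_of_pos hu']
    simp only [sub_re, neg_re, one_re]
    have h1 := abs_AA_le hu
    have e : u ^ (-(s.re - 1)) = u ^ 2 * u ^ (-s.re - 1) := by
      rw [← Real.rpow_two, ← Real.rpow_add hu']; ring_nf
    rw [e, ← mul_assoc]
    gcongr
  have hIntg := (integrable_EE_cpow hs).add ((integrable_AA_cpow hs).const_mul (-s - 1))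
  have hT := intervalIntegral_tendsto_integral_Ioi 1 hIntg tendsto_id
  have hT2 : Tendsto F atTop (𝓝 (∫ u in Ioi (1:ℝ), (((EE u : ℝ):ℂ) * (u:ℂ) ^ (-s - 1) +
      (-s - 1) * (((AA u : ℝ):ℂ) * (u:ℂ) ^ (-s - 2))))) := by
    refine hT.congr' ?_
    filter_upwards [eventually_ge_atTop 1] with u hu
    exact hFT u hu
  have h0 := tendsto_nhds_unique hT2 hlim
  rw [integral_add (integrable_EE_cpow hs) ((integrable_AA_cpow hs).const_mul (-s - 1)), integral_EE hs,
    integral_const_mul] at h0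
  rw [HH]
  generalize (∫ u in Ioi (1:ℝ), ((AA u : ℝ):ℂ) * (u:ℂ) ^ (-s - 2)) = J at h0 ⊢
  have h5 : (s + 1) * J = (- ZD s - 1) / s := by linear_combination -h0
  rw [← div_div, ← h5]
  field_simp

lemma mellin_AA {w : ℂ} (hw : w.re < -2) : mellin (fun x => (AA x : ℂ)) w = GG w := by
  have hs : 1 < (-1 - w).re := by simp; linarith
  rw [GG, ← integral_AA hs, mellin]
  have e : -(-1 - w) - 2 = w - 1 := by ring
  rw [e, ← integral_indicator measurableSet_Ioi, ← integral_indicator measurableSet_Ioi]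
  congr 1
  ext u
  by_cases h : 1 < u
  · rw [indicator_of_mem (by exact h : u ∈ Ioi (1:ℝ)), indicator_of_mem (by exact lt_trans one_pos h : u ∈ Ioi (0:ℝ)),
      smul_eq_mul, mul_comm]
  · rw [indicator_of_notMem (by simpa using h : u ∉ Ioi (1:ℝ))]
    rw [indicator_apply]
    split_ifs
    · simp [AA_zero (not_lt.1 h)]
    · rfl

end TC

namespace TC
open Complex MeasureTheory Set Filter Topology Asymptotics Metric

noncomputable def fk (k : ℕ) (x : ℝ) : ℂ := ((Real.log x ^ k * AA x : ℝ) : ℂ)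

lemma fk_zero (k : ℕ) (x : ℝ) (hx : x ≤ 1) : fk k x = 0 := by
  unfold fk; rw [AA_zero hx]; simp

lemma fk_cont (k : ℕ) : ContinuousOn (fk k) (Ioi 0) := by
  refine Complex.continuous_ofReal.comp_continuousOn ?_
  refine ContinuousOn.mul (ContinuousOn.pow ?_ k) continuous_AA.continuousOn
  exact Real.continuousOn_log.mono (fun x hx => ne_of_gt hx)

lemma fk_locInt (k : ℕ) : LocallyIntegrableOn (fk k) (Ioi 0) :=
  (fk_cont k).locallyIntegrableOn measurableSet_Ioi

lemma fk_top (k : ℕ) {a : ℝ} (ha : a < -2) : fk k =O[atTop] (fun x => x ^ (-a)) := by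
  have h1 : (fun x : ℝ => Real.log x ^ k) =O[atTop] fun x => x ^ (-a - 2) := by
    have := (isLittleO_log_rpow_rpow_atTop (s := -a - 2) (k:ℝ) (by linarith)).isBigO
    simpa using this
  have h2 : AA =O[atTop] fun x : ℝ => x ^ (2:ℝ) := by
    refine IsBigO.of_bound 6 ?_
    filter_upwards [eventually_ge_atTop 1] with x hx
    rw [Real.norm_eq_abs, Real.rpow_two, Real.norm_eq_abs, abs_of_nonneg (by positivity : 0 ≤ x ^ 2)]
    exact abs_AA_le hx
  have h3 := h1.mul h2
  have h4 : fk k =O[atTop] fun x : ℝ => Real.log x ^ k * AA x := by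
    refine IsBigO.of_bound 1 (Eventually.of_forall fun x => ?_)
    unfold fk; rw [Complex.norm_real, one_mul]
  refine (h4.trans h3).congr' EventuallyEq.rfl ?_
  filter_upwards [eventually_gt_atTop 0] with x hx
  rw [← Real.rpow_add hx]; ring_nf

lemma fk_mellin (k : ℕ) {w : ℂ} (hw : w.re < -2) :
    MellinConvergent (fk k) w ∧ HasDerivAt (mellin (fk k)) (mellin (fk (k+1)) w) w := by
  have h0 := bigO_zero_of_Ioi_one (fk_zero k) (w.re - 1)
  have ht := fk_top k (a := (w.re - 2) / 2) (by linarith)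
  refine ⟨mellinConvergent_of_isBigO_rpow (fk_locInt k) ht (by linarith) h0 (by linarith), ?_⟩
  have := (mellin_hasDerivAt_of_isBigO_rpow (s := w) (fk_locInt k) ht (by linarith) h0 (by linarith)).2
  have e : fk (k + 1) = fun t => Real.log t • fk k t := by
    funext x
    unfold fk
    rw [Complex.real_smul, ← Complex.ofReal_mul, pow_succ]
    ring_nf
  rw [e]
  exact this

lemma iter_mellin (k : ℕ) : ∀ {w : ℂ}, w.re < -2 → iteratedDeriv k GG w = mellin (fk k) w := by
  have hopen : IsOpen {w : ℂ | w.re < -2} := isOpen_lt continuous_re continuous_const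
  induction k with
  | zero =>
    intro w hw
    rw [iteratedDeriv_zero, ← mellin_AA hw]
    unfold fk; simp
  | succ k ih =>
    intro w hw
    rw [iteratedDeriv_succ]
    have : iteratedDeriv k GG =ᶠ[𝓝 w] mellin (fk k) := by
      filter_upwards [hopen.mem_nhds hw] with v hv
      exact ih hv
    rw [this.deriv_eq, (fk_mellin k hw).2.deriv]

lemma integral_weight : Integrable (fun t : ℝ => (1 + |t|) ^ (-(3 / 2) : ℝ)) ∧
    ∫ t : ℝ, (1 + |t|) ^ (-(3 / 2) : ℝ) = 4 := by
  have h2 : ∫ t in Ioi (0:ℝ), (1 + t) ^ (-(3 / 2) : ℝ) = 2 := by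
    have hd : ∀ t ∈ Ici (0:ℝ), HasDerivAt (fun t : ℝ => -2 * (1 + t) ^ (-(1 / 2) : ℝ)) ((1 + t) ^ (-(3 / 2) : ℝ)) t := by
      intro t ht
      have ht' : (0:ℝ) ≤ t := ht
      have h := (((hasDerivAt_id t).const_add 1).rpow_const (p := (-(1/2):ℝ)) (Or.inl (by simp; linarith))).const_mul (-2)
      refine h.congr_deriv ?_
      have : (-(1/2) - 1 : ℝ) = -(3/2) := by norm_num
      rw [this]; simp only [id]; ring
    have hlim : Tendsto (fun t : ℝ => -2 * (1 + t) ^ (-(1 / 2) : ℝ)) atTop (𝓝 (-2 * 0)) := by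
      refine Tendsto.const_mul _ ?_
      exact (tendsto_rpow_neg_atTop (by norm_num : (0:ℝ) < 1/2)).comp (tendsto_atTop_add_const_left _ 1 tendsto_id)
    have := integral_Ioi_of_hasDerivAt_of_nonneg' hd (fun t ht => by
      have : (0:ℝ) < t := ht
      positivity) hlim
    rw [this]; norm_num
  refine ⟨?_, ?_⟩
  · have := integrable_one_add_norm (E := ℝ) (μ := volume) (r := 3/2) (by norm_num)
    simpa using this
  · rw [integral_comp_abs (f := fun t => (1 + t) ^ (-(3 / 2) : ℝ)), h2]; norm_num

lemma AA_bound {x : ℝ} (hx : Real.exp 1 ≤ x) : |AA x| * Real.log x ^ 10 ≤ 6 * 10 ^ 74 * x ^ 2 := by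
  have hx1 : 1 < x := lt_of_lt_of_le (by have := Real.exp_one_gt_d9; linarith) hx
  have hx0 : 0 < x := by linarith
  have hl : 1 ≤ Real.log x := by rwa [Real.le_log_iff_exp_le hx0]
  set σ : ℝ := 1 + 1 / Real.log x with hσ
  have hσ1 : 1 < σ := by rw [hσ]; have : 0 < 1 / Real.log x := by positivity
                         linarith
  have hσ2 : σ ≤ 2 := by
    have : 1 / Real.log x ≤ 1 := by rw [div_le_one (by linarith)]; exact hl
    linarith
  have hre : ∀ y : ℝ, (((-1 - σ : ℝ) : ℂ) + y * I).re < -2 := by intro y; simp; linarith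
  have hbd : ∀ y : ℝ, ‖mellin (fk 10) (((-1 - σ : ℝ) : ℂ) + y * I)‖ ≤ 3 * 10 ^ 74 * (1 + |y|) ^ (-(3 / 2) : ℝ) := by
    intro y
    rw [← iter_mellin 10 (hre y)]
    exact GG_bound hσ1 hσ2
  have hIntg := integral_weight.1.const_mul (3 * 10 ^ 74)
  have hmc : Continuous (fun y : ℝ => mellin (fk 10) (((-1 - σ : ℝ) : ℂ) + y * I)) := by
    rw [continuous_iff_continuousAt]
    intro y
    have h1 := (fk_mellin 10 (hre y)).2.continuousAt
    exact ContinuousAt.comp (f := fun y : ℝ => ((-1 - σ : ℝ) : ℂ) + y * I) h1 (by fun_prop)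
  have hV : Complex.VerticalIntegrable (mellin (fk 10)) (-1 - σ) volume :=
    hIntg.mono' hmc.aestronglyMeasurable (ae_of_all _ hbd)
  have hinv := mellinInv_mellin_eq (-1 - σ) (fk 10) hx0 (fk_mellin 10 (by simp; linarith)).1 hV
    ((fk_cont 10).continuousAt (Ioi_mem_nhds hx0))
  have hn : ‖fk 10 x‖ = |AA x| * Real.log x ^ 10 := by
    unfold fk; rw [Complex.norm_real, Real.norm_eq_abs, abs_mul, abs_of_nonneg (by positivity : 0 ≤ Real.log x ^ 10), mul_comm]
  rw [← hn, ← hinv, mellinInv, norm_smul]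
  have hcp : x ^ (1 + σ) = x ^ 2 * Real.exp 1 := by
    have : x ^ (1 / Real.log x) = Real.exp 1 := by
      rw [Real.rpow_def_of_pos hx0]; congr 1; field_simp
    rw [hσ, ← add_assoc, Real.rpow_add hx0, this]; norm_num
  have h5 : ‖∫ y : ℝ, (x:ℂ) ^ (-(((-1 - σ : ℝ):ℂ) + y * I)) • mellin (fk 10) (((-1 - σ : ℝ):ℂ) + y * I)‖
      ≤ x ^ (1 + σ) * (3 * 10 ^ 74 * 4) := by
    rw [← integral_weight.2, ← integral_const_mul, ← integral_const_mul]
    refine norm_integral_le_of_norm_le (hIntg.const_mul _) (ae_of_all _ fun y => ?_)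
    rw [norm_smul, Complex.norm_cpow_eq_rpow_re_of_pos hx0]
    have e : (-(((-1 - σ : ℝ):ℂ) + y * I)).re = 1 + σ := by simp; ring
    rw [e]
    have := hbd y
    gcongr
  rw [hcp] at h5
  have hpi : ‖1 / (2 * π)‖ ≤ 1 / 6 := by
    have := Real.pi_gt_three
    rw [Real.norm_eq_abs, abs_of_pos (by positivity)]
    apply one_div_le_one_div_of_le (by norm_num); linarith
  have he := Real.exp_one_lt_d9
  calc _ ≤ 1 / 6 * (x ^ 2 * Real.exp 1 * (3 * 10 ^ 74 * 4)) := by gcongr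
    _ ≤ 1 / 6 * (x ^ 2 * 3 * (3 * 10 ^ 74 * 4)) := by gcongr; linarith
    _ = _ := by ring

end TC

namespace TC
open Complex MeasureTheory Set Filter Topology Asymptotics Metric

lemma AA_upper {x d : ℝ} (hx : 1 < x) (hd : 0 < d) :
    d * (Chebyshev.psi x - x - d) ≤ AA (x + d) - AA x := by
  have h1 : AA (x + d) - AA x = ∫ u in x..(x+d), EE u := by
    unfold AA
    rw [intervalIntegral.integral_interval_sub_left (intervalIntegrable_EE _ _) (intervalIntegrable_EE _ _)]
  have h2 : ∫ u in x..(x+d), (Chebyshev.psi x - x - d) = d * (Chebyshev.psi x - x - d) := by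
    rw [intervalIntegral.integral_const]; simp
  rw [h1, ← h2]
  refine intervalIntegral.integral_mono_on (by linarith) (by simp) (intervalIntegrable_EE _ _) ?_
  intro u hu
  rw [EE_of_gt (lt_of_lt_of_le hx hu.1)]
  have := Chebyshev.psi_mono hu.1
  linarith [hu.2]

lemma AA_lower {x d : ℝ} (hx : 1 < x - d) (hd : 0 < d) :
    AA x - AA (x - d) ≤ d * (Chebyshev.psi x - x + d) := by
  have h1 : AA x - AA (x - d) = ∫ u in (x-d)..x, EE u := by
    unfold AA
    rw [intervalIntegral.integral_interval_sub_left (intervalIntegrable_EE _ _) (intervalIntegrable_EE _ _)]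
  have h2 : ∫ u in (x-d)..x, (Chebyshev.psi x - x + d) = d * (Chebyshev.psi x - x + d) := by
    rw [intervalIntegral.integral_const]; simp
  rw [h1, ← h2]
  refine intervalIntegral.integral_mono_on (by linarith) (intervalIntegrable_EE _ _) (by simp) ?_
  intro u hu
  rw [EE_of_gt (lt_of_lt_of_le hx hu.1)]
  have := Chebyshev.psi_mono hu.2
  linarith [hu.1]

lemma theta_bound {x : ℝ} (hx0 : 0 < x) (hl : 4 * 10 ^ 13 ≤ Real.log x) :
    |Chebyshev.theta x - x| ≤ x / Real.log x ^ 2 := by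
  set l := Real.log x with hldef
  have hl0 : 0 < l := by linarith
  have hxe : x = Real.exp l := (Real.exp_log hx0).symm
  have hx1 : 1000 < x := by
    rw [hxe]; have := Real.add_one_le_exp l; linarith
  -- AA bound near x
  have hA : ∀ w, x / 2 ≤ w → w ≤ 2 * x → |AA w| ≤ 25 * 10 ^ 77 * x ^ 2 / l ^ 10 := by
    intro w hw1 hw2
    have hw0 : 0 < w := by linarith
    have hlw : l / 2 ≤ Real.log w := by
      have h1 : Real.log (x / 2) ≤ Real.log w := Real.log_le_log (by linarith) hw1
      rw [Real.log_div (by linarith) (by norm_num)] at h1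
      have := Real.log_two_lt_d9
      linarith
    have h2 := AA_bound (x := w) (by have := Real.exp_one_lt_d9; linarith)
    have h3 : (l / 2) ^ 10 ≤ Real.log w ^ 10 := by gcongr
    have h4 : |AA w| * (l/2)^10 ≤ 6 * 10 ^ 74 * w ^ 2 := le_trans (by gcongr) h2
    have h5 : w ^ 2 ≤ (2 * x) ^ 2 := by gcongr
    rw [le_div_iff₀ (by positivity)]
    have h6 : |AA w| * (l/2)^10 = |AA w| * l ^ 10 / 1024 := by ring
    rw [h6] at h4
    nlinarith [sq_nonneg x]
  set d := x / (4 * l ^ 2) with hd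
  have hd0 : 0 < d := by positivity
  have hdx : d ≤ x / 2 := by
    rw [hd]; gcongr; nlinarith
  have hl6 : (4 * 10 ^ 13) ^ 6 ≤ l ^ 6 := by gcongr
  have hkey : 2 * (25 * 10 ^ 77 * x ^ 2 / l ^ 10) ≤ d * d := by
    rw [hd, div_mul_div_comm, ← mul_div_assoc, div_le_div_iff₀ (by positivity) (by positivity)]
    have : 0 ≤ x ^ 2 * l ^ 4 := by positivity
    nlinarith [mul_le_mul_of_nonneg_left hl6 this]
  have hu : Chebyshev.psi x - x ≤ 2 * d := by
    have h1 := AA_upper (x := x) (by linarith) hd0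
    have h2 := abs_le.1 (hA (x + d) (by linarith) (by linarith))
    have h3 := abs_le.1 (hA x (by linarith) (by linarith))
    by_contra hc
    push Not at hc
    nlinarith [h2.1, h2.2, h3.1, h3.2]
  have hw : -(2 * d) ≤ Chebyshev.psi x - x := by
    have h1 := AA_lower (x := x) (d := d) (by linarith) hd0
    have h2 := abs_le.1 (hA (x - d) (by linarith) (by linarith))
    have h3 := abs_le.1 (hA x (by linarith) (by linarith))
    by_contra hc
    push Not at hc
    nlinarith [h2.1, h2.2, h3.1, h3.2]
  have h2d : 2 * d = x / l ^ 2 / 2 := by rw [hd]; field_simp; norm_num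
  have hth := Chebyshev.theta_le_psi x
  have hps := Chebyshev.psi_sub_theta_le (x := x) (by linarith)
  have hsq : 2 * √x * l ≤ x / l ^ 2 / 2 := by
    have hs : √x = Real.exp (l / 2) := by
      rw [hxe, ← Real.exp_half]
    have h1 := Real.pow_div_factorial_le_exp (l / 2) (by positivity) 4
    rw [← hs] at h1
    have h2 : x = √x * √x := (Real.mul_self_sqrt hx0.le).symm
    have h3 : 4 * l ^ 3 ≤ √x := by
      refine le_trans ?_ h1
      have : ((Nat.factorial 4 : ℕ) : ℝ) = 24 := by norm_num [Nat.factorial]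
      rw [this, le_div_iff₀ (by norm_num)]
      have : 0 < l ^ 3 := by positivity
      nlinarith
    rw [div_div, le_div_iff₀ (by positivity)]
    nth_rewrite 2 [h2]
    nlinarith [Real.sqrt_nonneg x]
  have hpos : 0 ≤ x / l ^ 2 := by positivity
  rw [abs_le]
  constructor <;> linarith

end TC

namespace TC
open Complex MeasureTheory Set Filter Topology Asymptotics Metric

lemma partial_sum {a b δ : ℝ} {g g' : ℝ → ℝ} (ha : 0 < a) (hab : a ≤ b)
    (hd : ∀ t ∈ Icc a b, HasDerivAt g (g' t) t) (hc : ContinuousOn g' (Icc a b))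
    (hn : ∀ t ∈ Icc a b, g' t ≤ 0) (hgb : 0 ≤ g b)
    (hθ : ∀ u ∈ Icc a b, |Chebyshev.theta u - u| ≤ δ * u) :
    ∑ p ∈ (Finset.Ioc ⌊a⌋₊ ⌊b⌋₊).filter Nat.Prime, g p * Real.log p
      ≤ (1 + δ) * (∫ u in a..b, g u) + 2 * δ * a * g a := by
  set c : ℕ → ℝ := fun k => if k.Prime then Real.log k else 0 with hcdef
  have hth : ∀ t : ℝ, ∑ k ∈ Finset.Icc 0 ⌊t⌋₊, c k = Chebyshev.theta t := by
    intro t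
    rw [Chebyshev.theta_eq_sum_Icc, Finset.sum_filter]
  have hderiv : EqOn (deriv g) g' (Icc a b) := fun t ht => (hd t ht).deriv
  have hIntg' : IntegrableOn g' (Icc a b) := hc.integrableOn_Icc
  have hIntg : IntegrableOn (deriv g) (Icc a b) :=
    hIntg'.congr_fun hderiv.symm measurableSet_Icc
  have hS := sum_mul_eq_sub_sub_integral_mul c (f := g) ha.le hab
    (fun t ht => (hd t ht).differentiableAt) hIntg
  have hL : ∑ p ∈ (Finset.Ioc ⌊a⌋₊ ⌊b⌋₊).filter Nat.Prime, g p * Real.log p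
      = ∑ k ∈ Finset.Ioc ⌊a⌋₊ ⌊b⌋₊, g k * c k := by
    rw [Finset.sum_filter]
    refine Finset.sum_congr rfl fun k _ => ?_
    simp only [hcdef]; split_ifs <;> simp
  rw [hL, hS, hth, hth]
  have hi1 : IntegrableOn (fun t => deriv g t * ∑ k ∈ Finset.Icc 0 ⌊t⌋₊, c k) (Ioc a b) :=
    (integrableOn_mul_sum_Icc c ha.le hIntg).mono_set Ioc_subset_Icc_self
  have hi2 : IntegrableOn (fun t => (1 + δ) * (t * g' t)) (Ioc a b) := by
    refine IntegrableOn.mono_set ?_ Ioc_subset_Icc_self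
    refine ContinuousOn.integrableOn_Icc ?_
    exact continuousOn_const.mul (continuousOn_id.mul hc)
  have hmono : ∫ t in Ioc a b, (1 + δ) * (t * g' t) ≤
      ∫ t in Ioc a b, deriv g t * ∑ k ∈ Finset.Icc 0 ⌊t⌋₊, c k := by
    refine setIntegral_mono_on hi2 hi1 measurableSet_Ioc fun t ht => ?_
    have ht' := Ioc_subset_Icc_self ht
    rw [hth, hderiv ht']
    have h1 := (abs_le.1 (hθ t ht')).2
    have h2 := hn t ht'
    nlinarith
  have hparts : ∫ t in a..b, t * g' t = b * g b - a * g a - ∫ t in a..b, g t := by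
    have hu : uIcc a b = Icc a b := uIcc_of_le hab
    have := intervalIntegral.integral_mul_deriv_eq_deriv_mul (a := a) (b := b) (u := fun t : ℝ => t) (v := g) (u' := fun _ => (1:ℝ)) (v' := g')
      (fun t _ => hasDerivAt_id t) (fun t ht => hd t (hu ▸ ht)) (by simp)
      (ContinuousOn.intervalIntegrable (by rwa [hu]))
    simpa using this
  rw [integral_const_mul, ← intervalIntegral.integral_of_le hab, hparts] at hmono
  have h1 := (abs_le.1 (hθ b ⟨hab, le_rfl⟩)).2
  have h2 := (abs_le.1 (hθ a ⟨le_rfl, hab⟩)).1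
  have hga : 0 ≤ g a := by
    have han : AntitoneOn g (Icc a b) := by
      refine antitoneOn_of_deriv_nonpos (convex_Icc a b) (fun t ht => (hd t ht).continuousAt.continuousWithinAt)
        (fun t ht => (hd t (interior_subset ht)).differentiableAt.differentiableWithinAt) fun t ht => ?_
      have := interior_subset ht
      rw [hderiv this]; exact hn t this
    exact hgb.trans (han ⟨le_rfl, hab⟩ ⟨hab, le_rfl⟩ hab)
  nlinarith

/-- Counting primes in `(y, x]`. -/
lemma count_primes {y x δ : ℝ} (hyx : y ≤ x) (hy0 : 0 < y) (hly : 100 ≤ Real.log y) (hδ : 0 ≤ δ) (hδ' : δ ≤ 1 / 10)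
    (hθ : ∀ u, y ≤ u → |Chebyshev.theta u - u| ≤ δ * u) :
    (((Finset.Ioc ⌊y⌋₊ ⌊x⌋₊).filter Nat.Prime).card : ℝ) ≤
      (1 + δ) * (x / Real.log x * (1 + 1.1 / Real.log x)) := by
  have hlog : ∀ u, y ≤ u → 100 ≤ Real.log u := fun u hu => hly.trans (Real.log_le_log hy0 hu)
  have h1 := partial_sum (g := fun u => (Real.log u)⁻¹) (g' := fun u => -(1/u) / (Real.log u)^2) hy0 hyx (δ := δ)
    (fun t ht => by
      have h0 : 0 < t := hy0.trans_le ht.1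
      have := hlog t ht.1
      have h2 := (Real.hasDerivAt_log h0.ne').inv (by linarith)
      exact h2.congr_deriv (by rw [one_div]))
    (by
      intro t ht
      have h0 : 0 < t := hy0.trans_le ht.1
      have := hlog t ht.1
      have h3 : Real.log t ≠ 0 := by linarith
      refine ContinuousAt.continuousWithinAt ?_
      have := Real.continuousAt_log h0.ne'
      refine ContinuousAt.div (ContinuousAt.neg (continuousAt_const.div continuousAt_id h0.ne')) (this.pow 2) (by positivity))
    (fun t ht => by
      have h0 : 0 < t := hy0.trans_le ht.1
      have : 0 ≤ 1 / t := by positivity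
      exact div_nonpos_of_nonpos_of_nonneg (by linarith) (by positivity))
    (by have := hlog x hyx; positivity) (fun u hu => hθ u hu.1)
  have h2 : (((Finset.Ioc ⌊y⌋₊ ⌊x⌋₊).filter Nat.Prime).card : ℝ) =
      ∑ p ∈ (Finset.Ioc ⌊y⌋₊ ⌊x⌋₊).filter Nat.Prime, (Real.log p)⁻¹ * Real.log p := by
    rw [Finset.sum_congr rfl (g := fun _ => (1:ℝ))]
    · simp
    · intro p hp
      have := (Finset.mem_filter.1 hp).2.one_lt
      have : 0 < Real.log p := Real.log_pos (by exact_mod_cast this)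
      field_simp
  rw [h2]
  refine h1.trans ?_
  set F : ℝ → ℝ := fun u => u / Real.log u * (1 + 1.1 / Real.log u) with hF
  have hIntg : ∫ u in y..x, (Real.log u)⁻¹ ≤ F x - F y := by
    have hFd : ∀ u ∈ Icc y x, HasDerivAt F ((Real.log u)⁻¹ + 0.1 / Real.log u ^ 2 - 2.2 / Real.log u ^ 3) u := by
      intro t ht
      have h0 : 0 < t := hy0.trans_le ht.1
      have := hlog t ht.1
      have hl0 : Real.log t ≠ 0 := by linarith
      have hl := Real.hasDerivAt_log h0.ne'
      have h3 := ((hasDerivAt_id t).div hl hl0).mul (((hasDerivAt_const t (1.1:ℝ)).div hl hl0).const_add 1)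
      refine h3.congr_deriv ?_
      simp only [id, Pi.div_apply]
      field_simp
      ring
    refine intervalIntegral.integral_le_sub_of_hasDeriv_right_of_le hyx
      (fun t ht => (hFd t ht).continuousAt.continuousWithinAt)
      (fun t ht => (hFd t (Ioo_subset_Icc_self ht)).hasDerivWithinAt) ?_ ?_
    · refine ContinuousOn.integrableOn_Icc fun t ht => ?_
      have h0 : 0 < t := hy0.trans_le ht.1
      have := hlog t ht.1
      exact ((Real.continuousAt_log h0.ne').inv₀ (by linarith)).continuousWithinAt
    · intro t ht
      have := hlog t ht.1.le
      have : 2.2 / Real.log t ^ 3 ≤ 0.1 / Real.log t ^ 2 := by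
        rw [div_le_div_iff₀ (by positivity) (by positivity)]
        have : 0 < Real.log t ^ 2 := by positivity
        nlinarith
      linarith
  have hFy : 2 * δ * y * (Real.log y)⁻¹ ≤ (1 + δ) * F y := by
    have h5 : y * (Real.log y)⁻¹ ≤ F y := by
      simp only [hF]
      rw [← div_eq_mul_inv]
      have h6 : 0 ≤ y / Real.log y := by positivity
      have : 0 ≤ 1.1 / Real.log y := by positivity
      nlinarith
    have : 0 ≤ y * (Real.log y)⁻¹ := by positivity
    nlinarith
  have := mul_le_mul_of_nonneg_left hIntg (by linarith : 0 ≤ 1 + δ)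
  show (1 + δ) * (∫ u in y..x, (Real.log u)⁻¹) + 2 * δ * y * (Real.log y)⁻¹ ≤ (1 + δ) * F x
  nlinarith

/-- Sum of `1/p` over primes in `(z, y]`. -/
lemma sum_inv {z y δ : ℝ} (hzy : z ≤ y) (hz0 : 0 < z) (hlz : 1 ≤ Real.log z)
    (hθ : ∀ u, z ≤ u → |Chebyshev.theta u - u| ≤ δ * u) :
    ∑ p ∈ (Finset.Ioc ⌊z⌋₊ ⌊y⌋₊).filter Nat.Prime, 1 / (p : ℝ) ≤
      (1 + δ) * Real.log (Real.log y / Real.log z) + 2 * δ / Real.log z := by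
  have hlog : ∀ u, z ≤ u → 1 ≤ Real.log u := fun u hu => hlz.trans (Real.log_le_log hz0 hu)
  have hc : ContinuousOn (fun u : ℝ => (u * Real.log u)⁻¹) (Icc z y) := by
    intro t ht
    have h0 : 0 < t := hz0.trans_le ht.1
    have := hlog t ht.1
    exact ((continuousAt_id.mul (Real.continuousAt_log h0.ne')).inv₀ (mul_pos h0 (by linarith)).ne').continuousWithinAt
  have h1 := partial_sum (g := fun u => (u * Real.log u)⁻¹) (g' := fun u => -(Real.log u + 1) / (u * Real.log u)^2) hz0 hzy (δ := δ)
    (fun t ht => by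
      have h0 : 0 < t := hz0.trans_le ht.1
      have := hlog t ht.1
      have h2 := ((hasDerivAt_id t).mul (Real.hasDerivAt_log h0.ne')).inv (by simp only [Pi.mul_apply, id]; positivity)
      refine h2.congr_deriv ?_
      simp only [Pi.mul_apply, id]
      field_simp)
    (by
      intro t ht
      have h0 : 0 < t := hz0.trans_le ht.1
      have := hlog t ht.1
      refine ContinuousAt.continuousWithinAt ?_
      have h3 := Real.continuousAt_log h0.ne'
      refine ContinuousAt.div ((h3.add continuousAt_const).neg) ((continuousAt_id.mul h3).pow 2) (by positivity))
    (fun t ht => by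
      have := hlog t ht.1
      exact div_nonpos_of_nonpos_of_nonneg (by linarith) (by positivity))
    (by have := hlog y hzy; have : 0 < y := by linarith
        positivity) (fun u hu => hθ u hu.1)
  have h2 : ∑ p ∈ (Finset.Ioc ⌊z⌋₊ ⌊y⌋₊).filter Nat.Prime, 1 / (p : ℝ) =
      ∑ p ∈ (Finset.Ioc ⌊z⌋₊ ⌊y⌋₊).filter Nat.Prime, ((p:ℝ) * Real.log p)⁻¹ * Real.log p := by
    refine Finset.sum_congr rfl fun p hp => ?_
    have := (Finset.mem_filter.1 hp).2.one_lt
    have : 0 < Real.log p := Real.log_pos (by exact_mod_cast this)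
    field_simp
  have h3 : ∫ u in z..y, (u * Real.log u)⁻¹ = Real.log (Real.log y / Real.log z) := by
    have hu : uIcc z y = Icc z y := uIcc_of_le hzy
    rw [intervalIntegral.integral_eq_sub_of_hasDerivAt (f := fun u => Real.log (Real.log u)), Real.log_div]
    · have := hlog y hzy; linarith
    · linarith
    · intro t ht
      rw [hu] at ht
      have h0 : 0 < t := hz0.trans_le ht.1
      have := hlog t ht.1
      refine ((Real.hasDerivAt_log h0.ne').log (by linarith)).congr_deriv ?_
      field_simp
    · exact ContinuousOn.intervalIntegrable (by rwa [hu])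
  rw [h2, ← h3]
  refine h1.trans (le_of_eq ?_)
  field_simp

end TC

namespace TC
open Complex MeasureTheory Set Filter Topology Asymptotics Metric

lemma D_deriv {t M : ℝ} (ht : 0 < t) :
    HasDerivAt (fun u => u * (Real.log u * (M - Real.log u)))
      (Real.log t * (M - Real.log t) + (M - 2 * Real.log t)) t := by
  have hl := Real.hasDerivAt_log ht.ne'
  have := (hasDerivAt_id t).mul (hl.mul (hl.const_sub M))
  refine this.congr_deriv ?_
  simp only [Pi.mul_apply, id]
  field_simp
  ring

lemma inner_sum {Y y δ : ℝ} (hY : 0 < Y) (hy0 : 0 < y) (hly : 1 ≤ Real.log y)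
    (hM : 2 * Real.log y ≤ Real.log Y)
    (hθ : ∀ u, y ≤ u → |Chebyshev.theta u - u| ≤ δ * u) :
    ∑ p ∈ (Finset.Ioc ⌊y⌋₊ ⌊√Y⌋₊).filter Nat.Prime, 1 / ((p : ℝ) * Real.log (Y / p)) ≤
      (1 + δ) * (Real.log ((Real.log Y - Real.log y) / Real.log y) / Real.log Y)
        + 2 * δ / (Real.log y * (Real.log Y - Real.log y)) := by
  set M := Real.log Y with hMdef
  have hs0 : 0 < √Y := Real.sqrt_pos.2 hY
  have hls : Real.log √Y = M / 2 := Real.log_sqrt hY.le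
  have hys : y ≤ √Y := by
    rw [← Real.log_le_log_iff hy0 hs0, hls]; linarith
  have hlog : ∀ u ∈ Icc y √Y, 0 < u ∧ 1 ≤ Real.log u ∧ Real.log u ≤ M / 2 := fun u hu =>
    ⟨hy0.trans_le hu.1, hly.trans (Real.log_le_log hy0 hu.1),
      hls ▸ Real.log_le_log (hy0.trans_le hu.1) hu.2⟩
  have hDpos : ∀ u ∈ Icc y √Y, 0 < u * (Real.log u * (M - Real.log u)) := by
    intro u hu
    obtain ⟨h0, h1, h2⟩ := hlog u hu
    exact mul_pos h0 (mul_pos (by linarith) (by linarith))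
  have hDc : ∀ u ∈ Icc y √Y, ContinuousAt (fun u => u * (Real.log u * (M - Real.log u))) u :=
    fun u hu => (D_deriv (hlog u hu).1).continuousAt
  have h1 := partial_sum (g := fun u => (u * (Real.log u * (M - Real.log u)))⁻¹)
    (g' := fun t => -(Real.log t * (M - Real.log t) + (M - 2 * Real.log t)) / (t * (Real.log t * (M - Real.log t)))^2)
    hy0 hys (δ := δ)
    (fun t ht => (D_deriv (hlog t ht).1).inv (hDpos t ht).ne')
    (by
      intro t ht
      refine ContinuousAt.continuousWithinAt ?_
      have h3 := Real.continuousAt_log (hlog t ht).1.ne'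
      refine ContinuousAt.div ?_ ((hDc t ht).pow 2) (pow_pos (hDpos t ht) 2).ne'
      exact ((h3.mul (continuousAt_const.sub h3)).add (continuousAt_const.sub (continuousAt_const.mul h3))).neg)
    (fun t ht => by
      obtain ⟨h0, h1, h2⟩ := hlog t ht
      refine div_nonpos_of_nonpos_of_nonneg ?_ (by positivity)
      nlinarith)
    (inv_nonneg.2 (hDpos _ ⟨hys, le_rfl⟩).le) (fun u hu => hθ u hu.1)
  have h2 : ∑ p ∈ (Finset.Ioc ⌊y⌋₊ ⌊√Y⌋₊).filter Nat.Prime, 1 / ((p : ℝ) * Real.log (Y / p)) =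
      ∑ p ∈ (Finset.Ioc ⌊y⌋₊ ⌊√Y⌋₊).filter Nat.Prime, ((p:ℝ) * (Real.log p * (M - Real.log p)))⁻¹ * Real.log p := by
    refine Finset.sum_congr rfl fun p hp => ?_
    have hp1 := (Finset.mem_filter.1 hp).2.one_lt
    have h3 : 0 < Real.log p := Real.log_pos (by exact_mod_cast hp1)
    have hp0 : (p:ℝ) ≠ 0 := by have : 0 < p := by omega
                               positivity
    rw [Real.log_div hY.ne' hp0, mul_inv, mul_inv, one_div, mul_inv]
    field_simp
    rfl
  have h3 : ∫ u in y..√Y, (u * (Real.log u * (M - Real.log u)))⁻¹ = Real.log ((M - Real.log y) / Real.log y) / M := by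
    have hu : uIcc y √Y = Icc y √Y := uIcc_of_le hys
    rw [intervalIntegral.integral_eq_sub_of_hasDerivAt (f := fun u => (Real.log (Real.log u) - Real.log (M - Real.log u)) / M), Real.log_div]
    · simp only [hls]
      rw [show M - M / 2 = M / 2 by ring]; ring
    · linarith
    · linarith
    · intro t ht
      rw [hu] at ht
      obtain ⟨h0, h1, h2⟩ := hlog t ht
      have hl := Real.hasDerivAt_log h0.ne'
      have a1 : Real.log t ≠ 0 := by linarith
      have a2 : M - Real.log t ≠ 0 := by linarith
      have a3 : M ≠ 0 := by linarith
      refine (((hl.log a1).sub ((hl.const_sub M).log a2)).div_const M).congr_deriv ?_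
      field_simp
      ring
    · refine ContinuousOn.intervalIntegrable ?_
      rw [hu]
      exact fun t ht => ((hDc t ht).inv₀ (hDpos t ht).ne').continuousWithinAt
  rw [h2, ← h3]
  refine h1.trans (le_of_eq ?_)
  have : 0 < M - Real.log y := by linarith
  field_simp

lemma outer_sum {L δ : ℝ} (hL : 8 ≤ L) (hδ : 0 ≤ δ)
    (hθ : ∀ u, Real.exp (L / 8) ≤ u → |Chebyshev.theta u - u| ≤ δ * u) :
    ∑ p ∈ (Finset.Ioc ⌊Real.exp (L / 8)⌋₊ ⌊Real.exp (L / 3)⌋₊).filter Nat.Prime,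
      Real.log (2 - 3 * (Real.log p / L)) / (L - Real.log p) / p ≤
      (1 + δ) * ((∫ β in (1 / 8 : ℝ)..(1 / 3 : ℝ), Real.log (2 - 3 * β) / (β * (1 - β))) / L)
        + 12 * δ / L ^ 2 := by
  have hL0 : 0 < L := by linarith
  set z := Real.exp (L / 8) with hz
  set y := Real.exp (L / 3) with hy
  have hz0 : 0 < z := Real.exp_pos _
  have hlz : Real.log z = L / 8 := Real.log_exp _
  have hly : Real.log y = L / 3 := Real.log_exp _
  have hzy : z ≤ y := Real.exp_le_exp.2 (by linarith)
  have hlog : ∀ u ∈ Icc z y, 0 < u ∧ L / 8 ≤ Real.log u ∧ Real.log u ≤ L / 3 := fun u hu =>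
    ⟨hz0.trans_le hu.1, hlz ▸ (Real.log_le_log hz0 hu.1),
      hly ▸ Real.log_le_log (hz0.trans_le hu.1) hu.2⟩
  have hDpos : ∀ u ∈ Icc z y, 0 < u * (Real.log u * (L - Real.log u)) := by
    intro u hu
    obtain ⟨h0, h1, h2⟩ := hlog u hu
    exact mul_pos h0 (mul_pos (by linarith) (by linarith))
  have hDc : ∀ u ∈ Icc z y, ContinuousAt (fun u => u * (Real.log u * (L - Real.log u))) u :=
    fun u hu => (D_deriv (hlog u hu).1).continuousAt
  have hA1 : ∀ u ∈ Icc z y, 1 ≤ 2 - 3 * (Real.log u / L) := by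
    intro u hu
    obtain ⟨h0, h1, h2⟩ := hlog u hu
    have : Real.log u / L ≤ 1 / 3 := by rw [div_le_iff₀ hL0]; linarith
    linarith
  have hAd : ∀ u ∈ Icc z y, HasDerivAt (fun u => Real.log (2 - 3 * (Real.log u / L)))
      (-(3 * (1 / u / L)) / (2 - 3 * (Real.log u / L))) u := by
    intro u hu
    have hl := Real.hasDerivAt_log (hlog u hu).1.ne'
    have := hA1 u hu
    have := (((hl.div_const L).const_mul 3).const_sub 2).log (by linarith)
    exact this.congr_deriv (by rw [one_div])
  have h1 := partial_sum (g := fun u => Real.log (2 - 3 * (Real.log u / L)) / (u * (Real.log u * (L - Real.log u))))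
    (g' := fun t => ((-(3 * (1 / t / L)) / (2 - 3 * (Real.log t / L))) * (t * (Real.log t * (L - Real.log t)))
      - Real.log (2 - 3 * (Real.log t / L)) * (Real.log t * (L - Real.log t) + (L - 2 * Real.log t))) / (t * (Real.log t * (L - Real.log t)))^2)
    hz0 hzy (δ := δ)
    (fun t ht => (hAd t ht).div (D_deriv (hlog t ht).1) (hDpos t ht).ne')
    (by
      intro t ht
      refine ContinuousAt.continuousWithinAt ?_
      have h0 := (hlog t ht).1
      have h3 := Real.continuousAt_log h0.ne'
      have h4 := (hAd t ht).continuousAt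
      have h5 := hA1 t ht
      refine ContinuousAt.div ?_ ((hDc t ht).pow 2) (pow_pos (hDpos t ht) 2).ne'
      refine ContinuousAt.sub (ContinuousAt.mul ?_ (hDc t ht)) (h4.mul ?_)
      · refine ContinuousAt.div ?_ (continuousAt_const.sub (continuousAt_const.mul (h3.div_const L))) (by linarith)
        exact (continuousAt_const.mul ((continuousAt_const.div continuousAt_id h0.ne').div_const L)).neg
      · exact ((h3.mul (continuousAt_const.sub h3)).add (continuousAt_const.sub (continuousAt_const.mul h3))))
    (fun t ht => by
      obtain ⟨h0, h1, h2⟩ := hlog t ht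
      refine div_nonpos_of_nonpos_of_nonneg ?_ (by positivity)
      have h5 := hA1 t ht
      have h6 : 0 ≤ Real.log (2 - 3 * (Real.log t / L)) := Real.log_nonneg h5
      have h7 : 0 ≤ Real.log t * (L - Real.log t) + (L - 2 * Real.log t) := by nlinarith
      have h8 : -(3 * (1 / t / L)) / (2 - 3 * (Real.log t / L)) ≤ 0 := by
        refine div_nonpos_of_nonpos_of_nonneg ?_ (by linarith)
        have : 0 ≤ 1 / t / L := by positivity
        linarith
      have := hDpos t ht
      nlinarith)
    (div_nonneg (Real.log_nonneg (hA1 y ⟨hzy, le_rfl⟩)) (hDpos _ ⟨hzy, le_rfl⟩).le) (fun u hu => hθ u hu.1)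
  have h2 : ∑ p ∈ (Finset.Ioc ⌊z⌋₊ ⌊y⌋₊).filter Nat.Prime, Real.log (2 - 3 * (Real.log p / L)) / (L - Real.log p) / p =
      ∑ p ∈ (Finset.Ioc ⌊z⌋₊ ⌊y⌋₊).filter Nat.Prime, Real.log (2 - 3 * (Real.log p / L)) / ((p:ℝ) * (Real.log p * (L - Real.log p))) * Real.log p := by
    refine Finset.sum_congr rfl fun p hp => ?_
    have hp1 := (Finset.mem_filter.1 hp).2.one_lt
    have h3 : 0 < Real.log p := Real.log_pos (by exact_mod_cast hp1)
    have hp0 : (p:ℝ) ≠ 0 := by have : 0 < p := by omega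
                               positivity
    rw [div_div, div_mul_eq_mul_div, mul_comm (p:ℝ), mul_assoc, mul_comm (Real.log (2 - _)), mul_div_mul_left _ _ h3.ne']
  have h3 : ∫ u in z..y, Real.log (2 - 3 * (Real.log u / L)) / (u * (Real.log u * (L - Real.log u))) =
      (∫ β in (1 / 8 : ℝ)..(1 / 3 : ℝ), Real.log (2 - 3 * β) / (β * (1 - β))) / L := by
    have hu : uIcc z y = Icc z y := uIcc_of_le hzy
    have hcv := intervalIntegral.integral_comp_mul_deriv'' (a := z) (b := y) (f := fun u => Real.log u / L)
      (f' := fun u => 1 / u / L) (g := fun β => Real.log (2 - 3 * β) / (β * (1 - β)))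
      (by
        rw [hu]
        exact fun t ht => ((Real.continuousAt_log (hlog t ht).1.ne').div_const L).continuousWithinAt)
      (by
        intro t ht
        rw [min_eq_left hzy, max_eq_right hzy] at ht
        have := (Real.hasDerivAt_log (hlog t (Ioo_subset_Icc_self ht)).1.ne').div_const L
        rw [one_div]
        exact this.hasDerivWithinAt)
      (by
        rw [hu]
        exact fun t ht => ((continuousAt_const.div continuousAt_id (hlog t ht).1.ne').div_const L).continuousWithinAt)
      (by
        rw [hu]
        rintro _ ⟨t, ht, rfl⟩
        obtain ⟨h0, h1, h2⟩ := hlog t ht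
        have h5 := hA1 t ht
        have e1 : 1 / 8 ≤ Real.log t / L := by rw [le_div_iff₀ hL0]; linarith
        have e2 : Real.log t / L ≤ 1 / 3 := by rw [div_le_iff₀ hL0]; linarith
        refine ContinuousAt.continuousWithinAt ?_
        refine ContinuousAt.div (ContinuousAt.log (by fun_prop) (by linarith)) (by fun_prop) ?_
        exact (mul_pos (by linarith) (by linarith)).ne')
    simp only [hlz, hly] at hcv
    rw [show L / 8 / L = 1 / 8 by field_simp, show L / 3 / L = 1 / 3 by field_simp] at hcv
    rw [← hcv, ← intervalIntegral.integral_div]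
    refine intervalIntegral.integral_congr fun t ht => ?_
    rw [hu] at ht
    obtain ⟨h0, h1, h2⟩ := hlog t ht
    have a1 : Real.log t ≠ 0 := by linarith
    have a2 : L - Real.log t ≠ 0 := by linarith
    have a3 : 1 - Real.log t / L ≠ 0 := by
      rw [one_sub_div hL0.ne']; exact div_ne_zero a2 hL0.ne'
    simp only [Function.comp]
    rw [one_sub_div hL0.ne']
    generalize Real.log (2 - 3 * (Real.log t / L)) = A
    field_simp
  rw [h2, ← h3]
  refine h1.trans ?_
  have hg : z * (Real.log (2 - 3 * (Real.log z / L)) / (z * (Real.log z * (L - Real.log z)))) ≤ 6 / L ^ 2 := by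
    rw [hlz, show 2 - 3 * (L / 8 / L) = 13 / 8 by field_simp; norm_num]
    have h5 : Real.log (13 / 8) ≤ 5 / 8 := by
      have := Real.log_le_sub_one_of_pos (x := 13 / 8) (by norm_num); linarith
    rw [← mul_div_assoc, mul_div_mul_left _ _ hz0.ne', div_le_div_iff₀ (by nlinarith) (by positivity)]
    nlinarith [sq_nonneg L]
  have : 2 * δ * z * (Real.log (2 - 3 * (Real.log z / L)) / (z * (Real.log z * (L - Real.log z)))) ≤ 12 * δ / L ^ 2 := by
    calc _ = 2 * δ * (z * (Real.log (2 - 3 * (Real.log z / L)) / (z * (Real.log z * (L - Real.log z))))) := by ring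
      _ ≤ 2 * δ * (6 / L ^ 2) := by gcongr
      _ = _ := by ring
  linarith

end TC

namespace TC
open Complex MeasureTheory Set Filter Topology Asymptotics Metric

lemma inner_real {L E b : ℝ} (hL : 0 < L) (hE : 0 ≤ E) (hb0 : 0 ≤ b) (hb : b ≤ L / 3) :
    Real.log ((L + E - b - L / 3) / (L / 3)) / (L + E - b) ≤
      Real.log (2 - 3 * (b / L)) / (L - b) + 4.5 * E / L ^ 2 := by
  set A := 2 - 3 * (b / L) with hA
  have hA1 : 1 ≤ A := by
    have : b / L ≤ 1 / 3 := by rw [div_le_iff₀ hL]; linarith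
    linarith
  have e1 : (L + E - b - L / 3) / (L / 3) = A + 3 * E / L := by
    rw [hA]; field_simp; ring
  have hc : 0 ≤ 3 * E / L := by positivity
  have h1 : Real.log (A + 3 * E / L) ≤ Real.log A + 3 * E / L := by
    have h2 := Real.log_le_sub_one_of_pos (x := (A + 3 * E / L) / A) (by positivity)
    rw [Real.log_div (by positivity) (by positivity)] at h2
    have h3 : (A + 3 * E / L) / A - 1 = 3 * E / L / A := by field_simp; ring
    have h4 : 3 * E / L / A ≤ 3 * E / L := div_le_self hc hA1
    linarith
  have h0 : 0 ≤ Real.log A := Real.log_nonneg hA1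
  rw [e1]
  have hLb : 2 * L / 3 ≤ L - b := by linarith
  have hLb0 : 0 < L - b := by linarith
  calc Real.log (A + 3 * E / L) / (L + E - b) ≤ (Real.log A + 3 * E / L) / (L - b) := by
        apply div_le_div₀ (by positivity) h1 hLb0 (by linarith)
    _ = Real.log A / (L - b) + 3 * E / L / (L - b) := by ring
    _ ≤ Real.log A / (L - b) + 3 * E / L / (2 * L / 3) := by gcongr
    _ = _ := by field_simp; ring

lemma exp_big : (4 * 10 ^ 13 : ℝ) ≤ Real.exp 31.52 := by
  have h1 := Real.exp_one_gt_d9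
  have h2 : Real.exp 31.52 = Real.exp 1 ^ 31 * Real.exp 0.52 := by
    rw [← Real.exp_nat_mul, ← Real.exp_add]; norm_num
  have h3 := Real.add_one_le_exp (0.52 : ℝ)
  rw [h2]
  have h4 : (2.7182818283 : ℝ) ^ 31 ≤ Real.exp 1 ^ 31 := by gcongr
  calc (4 * 10 ^ 13 : ℝ) ≤ 2.7182818283 ^ 31 * (0.52 + 1) := by norm_num
    _ ≤ _ := by gcongr

lemma delta_small {L k m : ℝ} (hL : 10 ^ 10 ≤ L) (hk : k ≤ 20) (hm : 1 ≤ m) :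
    k * (64 / L ^ 2) / L ^ 2 ≤ m / L ^ 3 := by
  have hL0 : 0 < L := by linarith
  rw [← mul_div_assoc, div_div, div_le_div_iff₀ (by positivity) (by positivity)]
  have h1 : 0 < L ^ 3 := by positivity
  have h2 : k * 64 ≤ m * L := by nlinarith
  calc k * 64 * L ^ 3 ≤ m * L * L ^ 3 := by gcongr
    _ = _ := by ring

lemma factor_bound {r ε δ : ℝ} (hr0 : 0 < r) (hr : r ≤ 1 / 10 ^ 10) (hε : 0 < ε) (hε' : ε < 1)
    (hδ0 : 0 ≤ δ) (hδ : δ ≤ r / 100) :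
    (1 + ε) * ((1 + δ) ^ 3 * (1 + 3.3 * r)) ≤ 1 + ε + 9 * r := by
  have hr1 : r ≤ 1 / 100 := hr.trans (by norm_num)
  have d1 : (1 + δ) ^ 3 ≤ 1 + 4 * δ := by nlinarith [mul_nonneg hδ0 hδ0]
  have d2 : (1 + δ) ^ 3 * (1 + 3.3 * r) ≤ 1 + 4.5 * r := by
    calc (1 + δ) ^ 3 * (1 + 3.3 * r) ≤ (1 + 0.04 * r) * (1 + 3.3 * r) := by
          gcongr; linarith
      _ ≤ _ := by nlinarith
  calc _ ≤ (1 + ε) * (1 + 4.5 * r) := by gcongr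
    _ ≤ _ := by nlinarith

set_option maxHeartbeats 1000000 in
lemma count_triples {L ε δ : ℝ} (hε : 0 < ε) (hε' : ε < 1) (hL : 10 ^ 10 ≤ L)
    (hδ : δ = 64 / L ^ 2)
    (hθ : ∀ u, Real.exp (L / 8) ≤ u → |Chebyshev.theta u - u| ≤ δ * u) :
    ∑ p ∈ (Finset.Ioc ⌊Real.exp (L / 8)⌋₊ ⌊Real.exp (L / 3)⌋₊).filter Nat.Prime,
      ∑ q ∈ (Finset.Ioc ⌊Real.exp (L / 3)⌋₊ ⌊√((1 + ε) * Real.exp L / p)⌋₊).filter Nat.Prime,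
        ((((Finset.Ioc ⌊Real.exp (L / 3)⌋₊ ⌊(1 + ε) * Real.exp L / p / q⌋₊).filter Nat.Prime).card : ℕ) : ℝ)
    ≤ (1 + ε + 9 / L) * Real.exp L *
        ((∫ β in (1 / 8 : ℝ)..(1 / 3 : ℝ), Real.log (2 - 3 * β) / (β * (1 - β))) / L +
          36 / L ^ 3 +
          (Real.log (8 / 3) + 64 / L ^ 2) * (10 * Real.log (1 + ε) / L ^ 2 + 27 / L ^ 3)) := by
  have hL0 : 0 < L := by linarith
  set X := (1 + ε) * Real.exp L with hX
  have hX0 : 0 < X := by have := Real.exp_pos L; positivity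
  set E := Real.log (1 + ε) with hE
  have hE0 : 0 ≤ E := Real.log_nonneg (by linarith)
  have hlX : Real.log X = L + E := by
    rw [hX, Real.log_mul (by linarith) (Real.exp_pos _).ne', Real.log_exp]; ring
  set c := ∫ β in (1 / 8 : ℝ)..(1 / 3 : ℝ), Real.log (2 - 3 * β) / (β * (1 - β)) with hc
  have hc0 : 0 ≤ c := by
    refine intervalIntegral.integral_nonneg (by norm_num) fun β hβ => ?_
    have h1 := hβ.1
    have h2 := hβ.2
    exact div_nonneg (Real.log_nonneg (by linarith)) (mul_nonneg (by linarith) (by linarith))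
  have hδ0 : 0 ≤ δ := by rw [hδ]; positivity
  have hδL : δ ≤ 1 / (100 * L) := by
    rw [hδ, div_le_div_iff₀ (by positivity) (by positivity)]; nlinarith
  have hiL : 1 / L ≤ 1 / 10 ^ 10 := one_div_le_one_div_of_le (by norm_num) hL
  have hiL0 : 0 < 1 / L := by positivity
  have hδ1 : δ ≤ 1 / 1000 := by
    have : 1 / (100 * L) = 1 / L / 100 := by field_simp
    rw [this] at hδL
    have h10 : (1:ℝ) / 10 ^ 10 ≤ 1 / 1000 := by norm_num
    linarith
  set z := Real.exp (L / 8) with hz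
  set y := Real.exp (L / 3) with hy
  have hlz : Real.log z = L / 8 := Real.log_exp _
  have hly : Real.log y = L / 3 := Real.log_exp _
  have hz0 : 0 < z := Real.exp_pos _
  have hy0 : 0 < y := Real.exp_pos _
  have hzy : z ≤ y := Real.exp_le_exp.2 (by linarith)
  set P1 := (Finset.Ioc ⌊z⌋₊ ⌊y⌋₊).filter Nat.Prime with hP1
  have hθy : ∀ u, y ≤ u → |Chebyshev.theta u - u| ≤ δ * u := fun u hu => hθ u (hzy.trans hu)
  -- facts on p in P1
  have hp1 : ∀ p ∈ P1, (0:ℝ) < p ∧ L / 8 ≤ Real.log p ∧ Real.log p ≤ L / 3 := by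
    intro p hp
    obtain ⟨h1, h2⟩ := Finset.mem_filter.1 hp
    obtain ⟨h3, h4⟩ := Finset.mem_Ioc.1 h1
    have h5 : z < p := (Nat.floor_lt hz0.le).1 h3
    have h6 : (p:ℝ) ≤ y := (Nat.le_floor_iff hy0.le).1 h4
    have h7 : (0:ℝ) < p := hz0.trans h5
    exact ⟨h7, hlz ▸ Real.log_le_log hz0 h5.le, hly ▸ Real.log_le_log h7 h6⟩
  set K := (1 + δ) * (1 + 3.3 / L) with hK
  have hK0 : 0 ≤ K := by positivity
  have hstep1 : ∀ p ∈ P1, ∀ q ∈ (Finset.Ioc ⌊y⌋₊ ⌊√(X / p)⌋₊).filter Nat.Prime,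
      ((((Finset.Ioc ⌊y⌋₊ ⌊X / p / q⌋₊).filter Nat.Prime).card : ℕ) : ℝ) ≤
        K * X / p * (1 / ((q:ℝ) * Real.log (X / p / q))) := by
    intro p hp q hq
    obtain ⟨hp0, hpa, hpb⟩ := hp1 p hp
    obtain ⟨h1, h2⟩ := Finset.mem_filter.1 hq
    obtain ⟨h3, h4⟩ := Finset.mem_Ioc.1 h1
    have h5 : y < q := (Nat.floor_lt hy0.le).1 h3
    have h6 : (q:ℝ) ≤ √(X / p) := (Nat.le_floor_iff (Real.sqrt_nonneg _)).1 h4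
    have hq0 : (0:ℝ) < q := hy0.trans h5
    have hx : y ≤ X / p / q := by
      rw [le_div_iff₀ hq0]
      calc y * q ≤ √(X / p) * √(X / p) := by gcongr; exact h5.le.trans h6
        _ = X / p := Real.mul_self_sqrt (by positivity)
    have h7 := count_primes hx hy0 (by rw [hly]; linarith) hδ0 (by linarith) hθy
    have hlx : L / 3 ≤ Real.log (X / p / q) := hly ▸ Real.log_le_log hy0 hx
    have hx0 : 0 < X / p / q := hy0.trans_le hx
    refine h7.trans ?_
    have h8 : 1.1 / Real.log (X / p / q) ≤ 3.3 / L := by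
      rw [div_le_div_iff₀ (by linarith) hL0]; linarith
    have h9 : 0 < Real.log (X / p / q) := by linarith
    calc (1 + δ) * (X / p / q / Real.log (X / p / q) * (1 + 1.1 / Real.log (X / p / q)))
        ≤ (1 + δ) * (X / p / q / Real.log (X / p / q) * (1 + 3.3 / L)) := by gcongr
      _ = K * X / p * (1 / ((q:ℝ) * Real.log (X / p / q))) := by rw [hK]; field_simp
  have hstep2 : ∀ p ∈ P1,
      ∑ q ∈ (Finset.Ioc ⌊y⌋₊ ⌊√(X / p)⌋₊).filter Nat.Prime, 1 / ((q:ℝ) * Real.log (X / p / q)) ≤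
        (1 + δ) * (Real.log (2 - 3 * (Real.log p / L)) / (L - Real.log p) + 4.5 * E / L ^ 2) + 18 * δ / L ^ 2 := by
    intro p hp
    obtain ⟨hp0, hpa, hpb⟩ := hp1 p hp
    have hlY : Real.log (X / p) = L + E - Real.log p := by
      rw [Real.log_div hX0.ne' hp0.ne', hlX]
    have h1 := inner_sum (Y := X / p) (y := y) (δ := δ) (by positivity) hy0 (by rw [hly]; linarith)
      (by rw [hly, hlY]; linarith) hθy
    refine h1.trans ?_
    rw [hly, hlY]
    have h2 := inner_real (L := L) (E := E) (b := Real.log p) hL0 hE0 (by linarith) hpb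
    have h3 : 2 * δ / (L / 3 * (L + E - Real.log p - L / 3)) ≤ 18 * δ / L ^ 2 := by
      calc 2 * δ / (L / 3 * (L + E - Real.log p - L / 3)) ≤ 2 * δ / (L / 3 * (L / 3)) := by
            gcongr; linarith
        _ = _ := by field_simp; ring
    gcongr
  have hout := outer_sum (by linarith) hδ0 hθ
  have hinv := sum_inv hzy hz0 (by rw [hlz]; linarith) hθ
  rw [hly, hlz, show L / 3 / (L / 8) = 8 / 3 by field_simp, show 2 * δ / (L / 8) = 16 * δ / L by field_simp; ring] at hinv
  set T := ∑ p ∈ P1, 1 / (p:ℝ) with hT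
  set U := ∑ p ∈ P1, Real.log (2 - 3 * (Real.log p / L)) / (L - Real.log p) / p with hU
  set l83 := Real.log (8 / 3) with hl83
  have hl0 : 0 ≤ l83 := Real.log_nonneg (by norm_num)
  have hmain : ∑ p ∈ P1, ∑ q ∈ (Finset.Ioc ⌊y⌋₊ ⌊√(X / p)⌋₊).filter Nat.Prime,
        ((((Finset.Ioc ⌊y⌋₊ ⌊X / p / q⌋₊).filter Nat.Prime).card : ℕ) : ℝ)
      ≤ K * X * ((1 + δ) * U + ((1 + δ) * (4.5 * E / L ^ 2) + 18 * δ / L ^ 2) * T) := by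
    have : K * X * ((1 + δ) * U + ((1 + δ) * (4.5 * E / L ^ 2) + 18 * δ / L ^ 2) * T) =
        ∑ p ∈ P1, K * X / p * ((1 + δ) * (Real.log (2 - 3 * (Real.log p / L)) / (L - Real.log p) + 4.5 * E / L ^ 2) + 18 * δ / L ^ 2) := by
      rw [hU, hT, Finset.mul_sum, Finset.mul_sum, ← Finset.sum_add_distrib, Finset.mul_sum]
      refine Finset.sum_congr rfl fun p _ => ?_
      ring
    rw [this]
    refine Finset.sum_le_sum fun p hp => ?_
    obtain ⟨hp0, hpa, hpb⟩ := hp1 p hp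
    refine (Finset.sum_le_sum (hstep1 p hp)).trans ?_
    rw [← Finset.mul_sum]
    have := hstep2 p hp
    gcongr
  refine hmain.trans ?_
  -- final algebra
  set B := c / L + 12 * δ / L ^ 2 + (4.5 * E / L ^ 2 + 18 * δ / L ^ 2) * (l83 + 16 * δ / L) with hB
  have hB0 : 0 ≤ B := by positivity
  have e1 : (1 + δ) * U + ((1 + δ) * (4.5 * E / L ^ 2) + 18 * δ / L ^ 2) * T ≤ (1 + δ) ^ 2 * B := by
    have a1 : U ≤ (1 + δ) * (c / L + 12 * δ / L ^ 2) := by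
      have : 0 ≤ δ * (12 * δ / L ^ 2) := by positivity
      linarith
    have a2 : T ≤ (1 + δ) * (l83 + 16 * δ / L) := by
      have : 0 ≤ δ * (16 * δ / L) := by positivity
      linarith
    have a3 : (1 + δ) * (4.5 * E / L ^ 2) + 18 * δ / L ^ 2 ≤ (1 + δ) * (4.5 * E / L ^ 2 + 18 * δ / L ^ 2) := by
      have : 0 ≤ δ * (18 * δ / L ^ 2) := by positivity
      linarith
    have a4 : 0 ≤ T := Finset.sum_nonneg fun p _ => by positivity
    calc _ ≤ (1 + δ) * ((1 + δ) * (c / L + 12 * δ / L ^ 2)) +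
          ((1 + δ) * (4.5 * E / L ^ 2 + 18 * δ / L ^ 2)) * ((1 + δ) * (l83 + 16 * δ / L)) := by gcongr
      _ = _ := by rw [hB]; ring
  have e2 : B ≤ c / L + 36 / L ^ 3 + (l83 + 64 / L ^ 2) * (10 * E / L ^ 2 + 27 / L ^ 3) := by
    have b1 : 12 * δ / L ^ 2 ≤ 36 / L ^ 3 := by
      rw [hδ]; exact delta_small hL (by norm_num) (by norm_num)
    have b2 : 18 * δ / L ^ 2 ≤ 27 / L ^ 3 := by
      rw [hδ]; exact delta_small hL (by norm_num) (by norm_num)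
    have b3 : 16 * δ / L ≤ 64 / L ^ 2 := by
      rw [← hδ, div_le_iff₀ hL0, mul_comm]; exact mul_le_mul_of_nonneg_left (by linarith) hδ0
    have b4 : 4.5 * E / L ^ 2 ≤ 10 * E / L ^ 2 := by gcongr; norm_num
    rw [hB, mul_comm (l83 + 64 / L ^ 2)]
    gcongr
  have e3 : K * X * (1 + δ) ^ 2 ≤ (1 + ε + 9 / L) * Real.exp L := by
    have d := factor_bound (r := 1 / L) hiL0 hiL hε hε' hδ0 (by rwa [div_div, mul_comm])
    rw [mul_one_div, mul_one_div] at d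
    calc K * X * (1 + δ) ^ 2 = (1 + ε) * ((1 + δ) ^ 3 * (1 + 3.3 / L)) * Real.exp L := by
          rw [hK, hX]; ring
      _ ≤ _ := by gcongr
  calc K * X * ((1 + δ) * U + ((1 + δ) * (4.5 * E / L ^ 2) + 18 * δ / L ^ 2) * T)
      ≤ K * X * ((1 + δ) ^ 2 * B) := by gcongr
    _ = K * X * (1 + δ) ^ 2 * B := by ring
    _ ≤ (1 + ε + 9 / L) * Real.exp L * B := by gcongr
    _ ≤ _ := by gcongr

end TC

namespace TC
open Set

lemma pow_ne_of_even {N p k : ℕ} (hN : Even N) (hbig : 1000 < N) (hp : p.Prime) (hk : k ≤ 8) : N ≠ p ^ k := by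
  intro h
  have h2 : 2 ∣ p ^ k := h ▸ hN.two_dvd
  have h3 := Nat.prime_two.dvd_of_dvd_pow h2
  have h4 : p = 2 := ((Nat.prime_dvd_prime_iff_eq Nat.prime_two hp).1 h3).symm
  rw [h4] at h
  have : 2 ^ k ≤ 2 ^ 8 := Nat.pow_le_pow_right (by norm_num) hk
  omega

lemma rpow_lt {N p k : ℕ} (hN : Even N) (hbig : 1000 < N) (hp : p.Prime) (hk0 : k ≠ 0) (hk : k ≤ 8)
    (h : (N:ℝ) ^ ((1:ℝ) / k) ≤ p) : (N:ℝ) ^ ((1:ℝ) / k) < p := by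
  refine lt_of_le_of_ne h fun he => pow_ne_of_even hN hbig hp hk ?_
  have : ((N:ℝ) ^ ((1:ℝ) / k)) ^ k = (p:ℝ) ^ k := by rw [he]
  rw [one_div, Real.rpow_inv_natCast_pow (by positivity) hk0] at this
  exact_mod_cast this

end TC

/-- Lemma 8.2: for `0 < ε₁ < 1` and even `N ≥ exp (8 exp 31.52)`, with `z = N^{1/8}`,
`y = N^{1/3}` and `c̄ = ∫_{1/8}^{1/3} log(2 - 3β)/(β(1-β)) dβ`, the number of prime
triples `(p₁, p₂, p₃)` with `z ≤ p₁ < y ≤ p₂ ≤ p₃` and `p₁p₂p₃ < (1+ε₁)N` is at most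
`(1 + ε₁ + 9/log N) N (c̄/log N + 36/(log N)³ +
(log(8/3) + 64/(log N)²)(10 log(1+ε₁)/(log N)² + 27/(log N)³))`. -/
theorem triple_count_bound (ε₁ : ℝ) (hε₁ : 0 < ε₁) (hε₁' : ε₁ < 1)
    (N : ℕ) (hN : Even N) (hNlarge : Real.exp (8 * Real.exp 31.52) ≤ (N : ℝ)) :
    ((Set.ncard {t : ℕ × ℕ × ℕ |
        Nat.Prime t.1 ∧ Nat.Prime t.2.1 ∧ Nat.Prime t.2.2 ∧
        (N : ℝ) ^ ((1 : ℝ) / 8) ≤ (t.1 : ℝ) ∧ (t.1 : ℝ) < (N : ℝ) ^ ((1 : ℝ) / 3) ∧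
        (N : ℝ) ^ ((1 : ℝ) / 3) ≤ (t.2.1 : ℝ) ∧ t.2.1 ≤ t.2.2 ∧
        ((t.1 * t.2.1 * t.2.2 : ℕ) : ℝ) < (1 + ε₁) * N}) : ℝ) ≤
      (1 + ε₁ + 9 / Real.log N) * N *
        ((∫ β in (1 / 8 : ℝ)..(1 / 3 : ℝ), Real.log (2 - 3 * β) / (β * (1 - β))) /
            Real.log N +
          36 / (Real.log N) ^ 3 +
          (Real.log (8 / 3) + 64 / (Real.log N) ^ 2) *
            (10 * Real.log (1 + ε₁) / (Real.log N) ^ 2 + 27 / (Real.log N) ^ 3)) := by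
  have hN0 : (0:ℝ) < N := lt_of_lt_of_le (Real.exp_pos _) hNlarge
  set L := Real.log N with hLdef
  have hexpL : Real.exp L = N := Real.exp_log hN0
  have hL8 : 8 * Real.exp 31.52 ≤ L := by rwa [hLdef, Real.le_log_iff_exp_le hN0]
  have hbigE := TC.exp_big
  have hLbig : 32 * 10 ^ 13 ≤ L := by linarith
  have hL0 : 0 < L := by linarith
  have hN1000 : 1000 < N := by
    have h1 := Real.add_one_le_exp L
    rw [hexpL] at h1
    have : (1000:ℝ) < N := by linarith
    exact_mod_cast this
  have hz : (N:ℝ) ^ ((1:ℝ) / 8) = Real.exp (L / 8) := by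
    rw [Real.rpow_def_of_pos hN0]; congr 1; ring
  have hy : (N:ℝ) ^ ((1:ℝ) / 3) = Real.exp (L / 3) := by
    rw [Real.rpow_def_of_pos hN0]; congr 1; ring
  have hθ : ∀ u, Real.exp (L / 8) ≤ u → |Chebyshev.theta u - u| ≤ 64 / L ^ 2 * u := by
    intro u hu
    have hu0 : 0 < u := (Real.exp_pos _).trans_le hu
    have hlu : L / 8 ≤ Real.log u := by rwa [Real.le_log_iff_exp_le hu0]
    refine (TC.theta_bound hu0 (by linarith)).trans ?_
    calc u / Real.log u ^ 2 ≤ u / (L / 8) ^ 2 := by gcongr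
      _ = _ := by field_simp; norm_num
  have hmain := TC.count_triples hε₁ hε₁' (by linarith) rfl hθ
  rw [hexpL] at hmain
  refine le_trans ?_ hmain
  set X := (1 + ε₁) * (N:ℝ) with hX
  set y := Real.exp (L / 3) with hyd
  set z := Real.exp (L / 8) with hzd
  have hz0 : 0 < z := Real.exp_pos _
  have hy0 : 0 < y := Real.exp_pos _
  set T : Finset (ℕ × ℕ × ℕ) := ((Finset.Ioc ⌊z⌋₊ ⌊y⌋₊).filter Nat.Prime).biUnion fun p =>
    ((Finset.Ioc ⌊y⌋₊ ⌊√(X / p)⌋₊).filter Nat.Prime).biUnion fun q =>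
      ((Finset.Ioc ⌊y⌋₊ ⌊X / p / q⌋₊).filter Nat.Prime).image fun r => (p, q, r) with hT
  have hcard : T.card ≤ ∑ p ∈ (Finset.Ioc ⌊z⌋₊ ⌊y⌋₊).filter Nat.Prime,
      ∑ q ∈ (Finset.Ioc ⌊y⌋₊ ⌊√(X / p)⌋₊).filter Nat.Prime,
        ((Finset.Ioc ⌊y⌋₊ ⌊X / p / q⌋₊).filter Nat.Prime).card := by
    refine Finset.card_biUnion_le.trans (Finset.sum_le_sum fun p _ => ?_)
    refine Finset.card_biUnion_le.trans (Finset.sum_le_sum fun q _ => ?_)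
    exact Finset.card_image_le
  refine le_trans ?_ (by exact_mod_cast hcard : (T.card : ℝ) ≤ _)
  rw [Nat.cast_le, ← Set.ncard_coe_finset T]
  refine Set.ncard_le_ncard ?_ T.finite_toSet
  rintro ⟨p, q, r⟩ ⟨hp, hq, hr, h1, h2, h3, h4, h5⟩
  simp only at hp hq hr h1 h2 h3 h4 h5
  have h1' := TC.rpow_lt (k := 8) hN hN1000 hp (by norm_num) (by norm_num) (by exact_mod_cast h1)
  have h3' := TC.rpow_lt (k := 3) hN hN1000 hq (by norm_num) (by norm_num) (by exact_mod_cast h3)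
  push_cast at h1' h3' h5
  rw [hz] at h1'
  rw [hy] at h2 h3'
  have hp0 : (0:ℝ) < p := hz0.trans h1'
  have hq0 : (0:ℝ) < q := hy0.trans h3'
  have hqr : (q:ℝ) ≤ r := by exact_mod_cast h4
  rw [Finset.mem_coe, hT]
  simp only [Finset.mem_biUnion, Finset.mem_image, Finset.mem_filter, Finset.mem_Ioc]
  refine ⟨p, ⟨⟨(Nat.floor_lt hz0.le).2 h1', Nat.le_floor h2.le⟩, hp⟩, q,
    ⟨⟨(Nat.floor_lt hy0.le).2 h3', Nat.le_floor ?_⟩, hq⟩, r,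
    ⟨⟨(Nat.floor_lt hy0.le).2 (h3'.trans_le hqr), Nat.le_floor ?_⟩, hr⟩, rfl⟩
  · refine Real.le_sqrt_of_sq_le ?_
    rw [le_div_iff₀ hp0]
    calc (q:ℝ) ^ 2 * p = p * q * q := by ring
      _ ≤ p * q * r := by gcongr
      _ ≤ X := h5.le
  · rw [le_div_iff₀ hq0, le_div_iff₀ hp0]
    calc (r:ℝ) * q * p = p * q * r := by ring
      _ ≤ X := h5.le
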